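/- arXiv:2106.03557 — 3 statements merged into one kernel-verified Lean document; each statement's English description precedes it below -/
import Mathlib

section
/- In every finite nonempty arrangement of orthogonal circles 𝒜 there exists a nonempty subset S ⊆ 𝒜 such that the number of unordered pairs {A, B} of intersecting circles of 𝒜 with at least one of A, B belonging to S is at most (4 + 5/11)·|S| = (49/11)·|S|. -/
open scoped Classical

/-- A circle in the Euclidean plane, given by a center and a positive radius. -/
structure Circ where
  center : EuclideanSpace ℝ (Fin 2)
  radius : ℝ
  radius_pos : 0 < radius

namespace Circ

/-- The circle as a point set: points at distance exactly `radius` from the center. -/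
def points (C : Circ) : Set (EuclideanSpace ℝ (Fin 2)) := Metric.sphere C.center C.radius

/-- The closed disk bounded by the circle. -/
def closedDisk (C : Circ) : Set (EuclideanSpace ℝ (Fin 2)) := Metric.closedBall C.center C.radius

/-- The open disk bounded by the circle. -/
def openDisk (C : Circ) : Set (EuclideanSpace ℝ (Fin 2)) := Metric.ball C.center C.radius

/-- Two circles intersect if they share a point. -/
def Intersects (A B : Circ) : Prop := (A.points ∩ B.points).Nonempty

/-- Two circles intersect orthogonally. -/
def Orthogonal (A B : Circ) : Prop :=
  Intersects A B ∧ dist A.center B.center ^ 2 = A.radius ^ 2 + B.radius ^ 2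

/-- Two circles are nested if the closed disk bounded by one is contained in the
closed disk bounded by the other. -/
def Nested (A B : Circ) : Prop :=
  A.closedDisk ⊆ B.closedDisk ∨ B.closedDisk ⊆ A.closedDisk

end Circ

open Circ

/-- Number of unordered pairs of circles of `𝒜` that intersect. -/
noncomputable def edgeCount (𝒜 : Finset Circ) : ℕ :=
  ((𝒜.powersetCard 2).filter fun e => ∃ A ∈ e, ∃ B ∈ e, A ≠ B ∧ Intersects A B).card

/-- Number of unordered pairs of intersecting circles of `𝒜` with at least one member in `S`. -/
noncomputable def incCount (𝒜 S : Finset Circ) : ℕ :=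
  ((𝒜.powersetCard 2).filter fun e =>
    (∃ A ∈ e, ∃ B ∈ e, A ≠ B ∧ Intersects A B) ∧ ∃ A ∈ e, A ∈ S).card

namespace Klein

/-- The standard inner product on `ℝ × ℝ`. -/
def dot (p q : ℝ × ℝ) : ℝ := p.1 * q.1 + p.2 * q.2

theorem dot_comm (p q : ℝ × ℝ) : dot p q = dot q p := by
  simp only [dot]; ring

theorem dot_self_pos {p : ℝ × ℝ} (hp : p ≠ 0) : 0 < dot p p := by
  rcases not_and_or.1 (mt (fun h : p.1 = 0 ∧ p.2 = 0 => Prod.ext h.1 h.2) hp) with h | h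
  · exact add_pos_of_pos_of_nonneg (mul_self_pos.2 h) (mul_self_nonneg _)
  · exact add_pos_of_nonneg_of_pos (mul_self_nonneg _) (mul_self_pos.2 h)

theorem exists_eq_add_rotate {c x y : ℝ × ℝ} (hc : 0 < dot c c) (h : dot x c = dot y c) :
    ∃ s, x.1 = y.1 - s * c.2 ∧ x.2 = y.2 + s * c.1 := by
  obtain ⟨s, hs⟩ : ∃ s, s * dot c c = c.1 * (x.2 - y.2) - c.2 * (x.1 - y.1) :=
    ⟨_, div_mul_cancel₀ _ hc.ne'⟩
  refine ⟨s, ?_, ?_⟩ <;> apply mul_left_cancel₀ hc.ne' <;> simp only [dot] at *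
  · linear_combination c.1 * h + c.2 * hs
  · linear_combination c.2 * h - c.1 * hs

/-- Two lines `{x | x · c = 1}`, `{x | x · d = 1}` meeting the open unit disc are orthogonal or
disjoint in the Klein model of the hyperbolic plane. -/
def OrthOrDisjoint (c d : ℝ × ℝ) : Prop :=
  dot c d = 1 ∨ (dot c c - 1) * (dot d d - 1) < (dot c d - 1) ^ 2

theorem OrthOrDisjoint.symm {c d : ℝ × ℝ} (h : OrthOrDisjoint c d) : OrthOrDisjoint d c := by
  unfold OrthOrDisjoint at *
  rwa [dot_comm d c, mul_comm]

theorem dot_eq_one_of_common_point {c d k : ℝ × ℝ} (h : OrthOrDisjoint c d)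
    (hk : dot k k < 1) (hc : dot k c = 1) (hd : dot k d = 1) : dot c d = 1 := by
  rcases h with h | h
  · exact h
  exfalso
  obtain ⟨c1, c2⟩ := c
  obtain ⟨d1, d2⟩ := d
  obtain ⟨k1, k2⟩ := k
  simp only [dot] at *
  have key : (k1 * k1 + k2 * k2) * (c1 * d2 - c2 * d1) = k1 * (d2 - c2) - k2 * (d1 - c1) := by
    linear_combination (k1 * d2 - k2 * d1) * hc - (k1 * c2 - k2 * c1) * hd
  have key2 : (k1 * (d2 - c2) - k2 * (d1 - c1)) ^ 2 =
      (k1 * k1 + k2 * k2) * ((d1 - c1) ^ 2 + (d2 - c2) ^ 2) := by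
    have e : k1 * (d1 - c1) + k2 * (d2 - c2) = 0 := by linarith
    linear_combination (-(k1 * (d1 - c1) + k2 * (d2 - c2))) * e
  have kpos : 0 < k1 * k1 + k2 * k2 := by
    refine dot_self_pos (p := (k1, k2)) fun h0 => ?_
    simp only [Prod.mk_eq_zero] at h0
    rw [h0.1, h0.2] at hc
    norm_num at hc
  have key3 : (k1 * k1 + k2 * k2) * (c1 * d2 - c2 * d1) ^ 2 = (d1 - c1) ^ 2 + (d2 - c2) ^ 2 := by
    apply mul_left_cancel₀ kpos.ne'
    rw [← key2, ← key]; ring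
  nlinarith [sq_nonneg (c1 * d2 - c2 * d1)]

theorem not_pairwise_orth {a b c : ℝ × ℝ} (ha : 1 < dot a a) (hb : 1 < dot b b)
    (hc : 1 < dot c c) (hab : dot a b = 1) (hbc : dot b c = 1) (hac : dot a c = 1) : False := by
  have gram : dot a a * dot b b * dot c c + 2 * (dot a b * dot b c * dot a c)
      - dot a a * dot b c ^ 2 - dot b b * dot a c ^ 2 - dot c c * dot a b ^ 2 = 0 := by
    simp only [dot]; ring
  rw [hab, hbc, hac] at gram
  have h1 := mul_pos (sub_pos.2 ha) (sub_pos.2 hb)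
  have h2 := mul_pos (sub_pos.2 hb) (sub_pos.2 hc)
  have h3 := mul_pos (sub_pos.2 ha) (sub_pos.2 hc)
  have h4 := mul_pos h1 (sub_pos.2 hc)
  nlinarith

theorem not_orth_four_cycle {a b c d : ℝ × ℝ} (hac : a ≠ c) (hbd : b ≠ d)
    (hab : dot a b = 1) (hbc : dot b c = 1) (hcd : dot c d = 1) (hda : dot d a = 1) : False := by
  obtain ⟨a1, a2⟩ := a
  obtain ⟨b1, b2⟩ := b
  obtain ⟨c1, c2⟩ := c
  obtain ⟨d1, d2⟩ := d
  simp only [dot] at *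
  have e1 : (a1 - c1) * (b1 - d1) + (a2 - c2) * (b2 - d2) = 0 := by linarith
  have e2 : a1 * (b1 - d1) + a2 * (b2 - d2) = 0 := by linarith
  have e3 : (a1 - c1) * b1 + (a2 - c2) * b2 = 0 := by linarith
  have hne : b1 - d1 ≠ 0 ∨ b2 - d2 ≠ 0 := by
    by_contra! h
    exact hbd (Prod.ext (sub_eq_zero.1 h.1) (sub_eq_zero.1 h.2))
  have hne' : a1 - c1 ≠ 0 ∨ a2 - c2 ≠ 0 := by
    by_contra! h
    exact hac (Prod.ext (sub_eq_zero.1 h.1) (sub_eq_zero.1 h.2))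
  -- `a` is orthogonal to `b - d`, which is parallel to `b`
  have e4 : b1 * (b2 - d2) - b2 * (b1 - d1) = 0 := by
    rcases hne' with h | h
    · apply mul_left_cancel₀ h
      linear_combination (b2 - d2) * e3 - b2 * e1
    · apply mul_left_cancel₀ h
      linear_combination b1 * e1 - (b1 - d1) * e3
  rcases hne with h | h
  · apply h
    linear_combination (-(b1 - d1)) * hab + b1 * e2 - a2 * e4
  · apply h
    linear_combination (-(b2 - d2)) * hab + b2 * e2 + a1 * e4

theorem exists_common_point {c d : ℝ × ℝ} (hc : 1 < dot c c) (hd : 1 < dot d d)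
    (h : dot c d = 1) : ∃ x, dot x x < 1 ∧ dot x c = 1 ∧ dot x d = 1 := by
  have hpos : 0 < dot c c * dot d d - 1 := by nlinarith
  refine ⟨(((dot d d - 1) * c.1 + (dot c c - 1) * d.1) / (dot c c * dot d d - 1),
    ((dot d d - 1) * c.2 + (dot c c - 1) * d.2) / (dot c c * dot d d - 1)), ?_, ?_, ?_⟩
  · have e : dot (((dot d d - 1) * c.1 + (dot c c - 1) * d.1) / (dot c c * dot d d - 1),
      ((dot d d - 1) * c.2 + (dot c c - 1) * d.2) / (dot c c * dot d d - 1))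
      (((dot d d - 1) * c.1 + (dot c c - 1) * d.1) / (dot c c * dot d d - 1),
      ((dot d d - 1) * c.2 + (dot c c - 1) * d.2) / (dot c c * dot d d - 1)) =
      ((dot d d - 1) ^ 2 * dot c c + 2 * (dot d d - 1) * (dot c c - 1) * dot c d +
        (dot c c - 1) ^ 2 * dot d d) / (dot c c * dot d d - 1) ^ 2 := by
      simp only [dot]; field_simp; ring
    rw [e, h, div_lt_one (by positivity)]
    nlinarith [mul_pos (sub_pos.2 hc) (sub_pos.2 hd),
      mul_pos (mul_pos (sub_pos.2 hc) (sub_pos.2 hd)) hpos]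
  · have e : ∀ v : ℝ × ℝ, dot
      (((dot d d - 1) * c.1 + (dot c c - 1) * d.1) / (dot c c * dot d d - 1),
      ((dot d d - 1) * c.2 + (dot c c - 1) * d.2) / (dot c c * dot d d - 1)) v =
      ((dot d d - 1) * dot c v + (dot c c - 1) * dot d v) / (dot c c * dot d d - 1) := by
      intro v; simp only [dot]; field_simp; ring
    rw [e, dot_comm d c, h, div_eq_one_iff_eq hpos.ne']; ring
  · have e : ∀ v : ℝ × ℝ, dot
      (((dot d d - 1) * c.1 + (dot c c - 1) * d.1) / (dot c c * dot d d - 1),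
      ((dot d d - 1) * c.2 + (dot c c - 1) * d.2) / (dot c c * dot d d - 1)) v =
      ((dot d d - 1) * dot c v + (dot c c - 1) * dot d v) / (dot c c * dot d d - 1) := by
      intro v; simp only [dot]; field_simp; ring
    rw [e, h, div_eq_one_iff_eq hpos.ne']; ring

theorem dot_self_convex_lt {x y : ℝ × ℝ} (hx : dot x x < 1) (hy : dot y y < 1) {s t : ℝ}
    (hs : 0 ≤ s) (ht : 0 ≤ t) (hst : s + t = 1) :
    dot (s * x.1 + t * y.1, s * x.2 + t * y.2) (s * x.1 + t * y.1, s * x.2 + t * y.2) < 1 := by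
  have e : dot (s * x.1 + t * y.1, s * x.2 + t * y.2) (s * x.1 + t * y.1, s * x.2 + t * y.2) =
      (s + t) * (s * dot x x + t * dot y y) - s * t * ((x.1 - y.1) ^ 2 + (x.2 - y.2) ^ 2) := by
    simp only [dot]; ring
  rw [e, hst]
  have h1 : 0 ≤ s * t * ((x.1 - y.1) ^ 2 + (x.2 - y.2) ^ 2) := by positivity
  rcases hs.eq_or_lt with h | h
  · have : t = 1 := by linarith
    subst this; subst h; linarith
  · nlinarith

/-- A line meeting both closed sides of another line within the disc is orthogonal to it. -/
theorem dot_eq_one_of_sides {b d x y : ℝ × ℝ} (h : OrthOrDisjoint b d) (hx : dot x x < 1)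
    (hy : dot y y < 1) (hxd : dot x d = 1) (hyd : dot y d = 1) (hxb : dot x b ≤ 1)
    (hyb : 1 ≤ dot y b) : dot b d = 1 := by
  rcases hyb.eq_or_lt with hyb' | hyb'
  · exact dot_eq_one_of_common_point h hy hyb'.symm hyd
  have hpos : 0 < dot y b - dot x b := by linarith
  set s := (dot y b - 1) / (dot y b - dot x b)
  set t := (1 - dot x b) / (dot y b - dot x b)
  have hst : s + t = 1 := by simp only [s, t]; field_simp; ring
  have e : ∀ v : ℝ × ℝ, dot (s * x.1 + t * y.1, s * x.2 + t * y.2) v =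
      s * dot x v + t * dot y v := by
    intro v; simp only [dot]; ring
  refine dot_eq_one_of_common_point h (k := (s * x.1 + t * y.1, s * x.2 + t * y.2))
    (dot_self_convex_lt hx hy (by apply div_nonneg <;> linarith)
      (by apply div_nonneg <;> linarith) hst) ?_ ?_
  · rw [e]; simp only [s, t]; field_simp; ring
  · rw [e, hxd, hyd]; linarith

/-- Two points of a line disjoint from `b` lie strictly on the same side of `b`. -/
theorem same_side_of_ne {b d x y : ℝ × ℝ} (h : OrthOrDisjoint b d) (hbd : dot b d ≠ 1)
    (hx : dot x x < 1) (hy : dot y y < 1) (hxd : dot x d = 1) (hyd : dot y d = 1) :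
    0 < (dot x b - 1) * (dot y b - 1) := by
  by_contra! hle
  rcases mul_nonpos_iff.1 hle with ⟨h1, h2⟩ | ⟨h1, h2⟩
  · exact hbd (dot_eq_one_of_sides h hy hx hyd hxd (by linarith) (by linarith))
  · exact hbd (dot_eq_one_of_sides h hx hy hxd hyd (by linarith) (by linarith))

/-- Points on a line ordered along that line: the middle one separates the others with respect to
any line through it. -/
theorem mul_nonpos_of_between {l c x y z : ℝ × ℝ} (hl : l ≠ 0) (hx : dot x l = 1)
    (hy : dot y l = 1) (hz : dot z l = 1) (hyc : dot y c = 1)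
    (hxy : l.1 * x.2 - l.2 * x.1 < l.1 * y.2 - l.2 * y.1)
    (hyz : l.1 * y.2 - l.2 * y.1 < l.1 * z.2 - l.2 * z.1) :
    (dot x c - 1) * (dot z c - 1) ≤ 0 := by
  obtain ⟨l1, l2⟩ := l
  obtain ⟨c1, c2⟩ := c
  obtain ⟨x1, x2⟩ := x
  obtain ⟨y1, y2⟩ := y
  obtain ⟨z1, z2⟩ := z
  simp only [dot] at *
  have lpos : 0 < l1 * l1 + l2 * l2 := dot_self_pos (p := (l1, l2)) hl
  set m := l1 * c2 - l2 * c1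
  have e1 : (l1 * l1 + l2 * l2) * (x1 * c1 + x2 * c2 - 1) =
      m * ((l1 * x2 - l2 * x1) - (l1 * y2 - l2 * y1)) := by
    simp only [m]
    linear_combination (l1*l1+l2*l2) * hyc + (l1 * c1 + l2 * c2) * (hx - hy)
  have e3 : (l1 * l1 + l2 * l2) * (z1 * c1 + z2 * c2 - 1) =
      m * ((l1 * z2 - l2 * z1) - (l1 * y2 - l2 * y1)) := by
    simp only [m]
    linear_combination (l1*l1+l2*l2) * hyc + (l1 * c1 + l2 * c2) * (hz - hy)
  have : 0 ≤ m ^ 2 * ((l1 * y2 - l2 * y1) - (l1 * x2 - l2 * x1)) *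
      ((l1 * z2 - l2 * z1) - (l1 * y2 - l2 * y1)) :=
    mul_nonneg (mul_nonneg (sq_nonneg _) (by linarith)) (by linarith)
  have e : (l1 * l1 + l2 * l2) ^ 2 * ((x1 * c1 + x2 * c2 - 1) * (z1 * c1 + z2 * c2 - 1)) ≤ 0 := by
    calc _ = ((l1 * l1 + l2 * l2) * (x1 * c1 + x2 * c2 - 1)) *
          ((l1 * l1 + l2 * l2) * (z1 * c1 + z2 * c2 - 1)) := by ring
      _ = -(m ^ 2 * ((l1 * y2 - l2 * y1) - (l1 * x2 - l2 * x1)) *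
      ((l1 * z2 - l2 * z1) - (l1 * y2 - l2 * y1))) := by rw [e1, e3]; ring
      _ ≤ 0 := by linarith
  by_contra! h
  have := mul_pos (pow_pos lpos 2) h
  linarith

theorem mul_corner_identity {c d z a b : ℝ × ℝ} (hc : 1 < dot c c) (hd : 1 < dot d d)
    (h : dot c d = 1) (hzc : dot z c = 1) (hzd : dot z d = 1) (hac : dot a c = 1)
    (hbd : dot b d = 1) :
    (1 - dot a b) * (1 - dot z z) = (1 - dot a z) * (1 - dot b z) := by
  obtain ⟨s, hs1, hs2⟩ := exists_eq_add_rotate (by linarith) (hac.trans hzc.symm)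
  obtain ⟨t, ht1, ht2⟩ := exists_eq_add_rotate (by linarith) (hbd.trans hzd.symm)
  obtain ⟨c1, c2⟩ := c
  obtain ⟨d1, d2⟩ := d
  obtain ⟨z1, z2⟩ := z
  obtain ⟨a1, a2⟩ := a
  obtain ⟨b1, b2⟩ := b
  simp only [dot] at *
  have e : (z2 * c1 - z1 * c2) * (z2 * d1 - z1 * d2) = z1 * z1 + z2 * z2 - 1 := by
    linear_combination (z1 * z1 + z2 * z2) * h - (z1 * d1 + z2 * d2) * hzc - hzd
  subst hs1 hs2 ht1 ht2
  linear_combination (-s * t) * e - s * t * (1 - (z1 * z1 + z2 * z2)) * h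

/-- Among three disjoint lines with a common perpendicular, one separates the other two. -/
theorem not_three_mutually_supporting {l a b c x y z : ℝ × ℝ}
    (hl : 1 < dot l l) (ha : 1 < dot a a) (hb : 1 < dot b b) (hc : 1 < dot c c)
    (hla : dot l a = 1) (hlb : dot l b = 1) (hlc : dot l c = 1)
    (hab : OrthOrDisjoint a b) (hac : OrthOrDisjoint a c) (hbc : OrthOrDisjoint b c)
    (hx : dot x x < 1) (hy : dot y y < 1) (hz : dot z z < 1)
    (hxa : dot x a = 1) (hyb : dot y b = 1) (hzc : dot z c = 1)
    (h1 : 0 ≤ (dot y a - 1) * (dot z a - 1)) (h2 : 0 ≤ (dot x b - 1) * (dot z b - 1))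
    (h3 : 0 ≤ (dot x c - 1) * (dot y c - 1)) : False := by
  have nab : dot a b ≠ 1 := fun h => not_pairwise_orth hl ha hb hla h hlb
  have nac : dot a c ≠ 1 := fun h => not_pairwise_orth hl ha hc hla h hlc
  have nbc : dot b c ≠ 1 := fun h => not_pairwise_orth hl hb hc hlb h hlc
  have hl0 : l ≠ 0 := by
    rintro rfl
    simp only [dot, Prod.fst_zero, Prod.snd_zero] at hl
    norm_num at hl
  -- replace the given points by the feet on the common perpendicular
  obtain ⟨x', hx', hx'l, hx'a⟩ := exists_common_point hl ha hla
  obtain ⟨y', hy', hy'l, hy'b⟩ := exists_common_point hl hb hlb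
  obtain ⟨z', hz', hz'l, hz'c⟩ := exists_common_point hl hc hlc
  have key : ∀ {s d e p q p' q' : ℝ × ℝ}, OrthOrDisjoint s d → OrthOrDisjoint s e →
      dot s d ≠ 1 → dot s e ≠ 1 → dot p p < 1 → dot p' p' < 1 → dot q q < 1 → dot q' q' < 1 →
      dot p d = 1 → dot p' d = 1 → dot q e = 1 → dot q' e = 1 →
      0 ≤ (dot p s - 1) * (dot q s - 1) → 0 < (dot p' s - 1) * (dot q' s - 1) := by
    intro s d e p q p' q' hsd hse nsd nse hp hp' hq hq' hpd hpd' hqe hqe' hpq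
    have e1 := same_side_of_ne hsd nsd hp hp' hpd hpd'
    have e2 := same_side_of_ne hse nse hq hq' hqe hqe'
    have e3 := mul_pos e1 e2
    rcases hpq.eq_or_lt with h | h
    · have : (dot p s - 1) * (dot p' s - 1) * ((dot q s - 1) * (dot q' s - 1)) = 0 := by
        linear_combination (-(dot p' s - 1) * (dot q' s - 1)) * h
      linarith
    · by_contra! hle
      have := mul_nonpos_of_nonneg_of_nonpos h.le hle
      linarith
  have h1' := key hab hac nab nac hy hy' hz hz' hyb hy'b hzc hz'c h1
  have h2' := key hab.symm hbc (by rwa [dot_comm]) nbc hx hx' hz hz' hxa hx'a hzc hz'c h2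
  have h3' := key hac.symm hbc.symm (by rwa [dot_comm]) (by rwa [dot_comm])
    hx hx' hy hy' hxa hx'a hyb hy'b h3
  have hne : ∀ {s t p q : ℝ × ℝ}, OrthOrDisjoint s t → dot s t ≠ 1 → dot p p < 1 → dot p l = 1 →
      dot q l = 1 → dot p s = 1 → dot q t = 1 →
      l.1 * p.2 - l.2 * p.1 ≠ l.1 * q.2 - l.2 * q.1 := by
    intro s t p q hst nst hp hpl hql hps hqt heq
    obtain ⟨r, hr1, hr2⟩ := exists_eq_add_rotate (zero_lt_one.trans hl) (hpl.trans hql.symm)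
    have hr : r * dot l l = 0 := by
      simp only [dot]
      rw [hr1, hr2] at heq
      linear_combination heq
    have hr0 : r = 0 := (mul_eq_zero.1 hr).resolve_right (by linarith)
    have hpq : p = q := Prod.ext (by rw [hr1, hr0]; ring) (by rw [hr2, hr0]; ring)
    exact nst (dot_eq_one_of_common_point hst hp hps (hpq ▸ hqt))
  have exy := hne hab nab hx' hx'l hy'l hx'a hy'b
  have exz := hne hac nac hx' hx'l hz'l hx'a hz'c
  have eyz := hne hbc nbc hy' hy'l hz'l hy'b hz'c
  rcases lt_or_gt_of_ne exy with oxy | oxy <;> rcases lt_or_gt_of_ne exz with oxz | oxz <;>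
    rcases lt_or_gt_of_ne eyz with oyz | oyz
  · linarith [mul_nonpos_of_between hl0 hx'l hy'l hz'l hy'b oxy oyz]
  · linarith [mul_nonpos_of_between hl0 hx'l hz'l hy'l hz'c oxz oyz]
  · linarith
  · linarith [mul_nonpos_of_between hl0 hz'l hx'l hy'l hx'a oxz oxy]
  · linarith [mul_nonpos_of_between hl0 hy'l hx'l hz'l hx'a oxy oxz]
  · linarith
  · linarith [mul_nonpos_of_between hl0 hy'l hz'l hx'l hz'c oyz oxz]
  · linarith [mul_nonpos_of_between hl0 hz'l hy'l hx'l hy'b oyz oxy]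

end Klein

namespace PlaneDrawing

variable {ι : Type*}

/-- The slope of the segment joining the images of the endpoints of `e`. -/
noncomputable def slope (x y : ι → ℝ) (e : ι × ι) : ℝ := (y e.2 - y e.1) / (x e.2 - x e.1)

/-- The height at abscissa `t` of the line carrying the segment `e`. -/
noncomputable def height (x y : ι → ℝ) (e : ι × ι) (t : ℝ) : ℝ :=
  y e.1 + slope x y e * (t - x e.1)

/-- The segments `E`, directed from left to right, with endpoints among the points `(x v, y v)`,
`v ∈ V`, form a plane straight-line drawing. -/
structure IsPlane (V : Finset ι) (E : Finset (ι × ι)) (x y : ι → ℝ) : Prop where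
  inj : Set.InjOn x V
  fst_mem : ∀ e ∈ E, e.1 ∈ V
  snd_mem : ∀ e ∈ E, e.2 ∈ V
  lt : ∀ e ∈ E, x e.1 < x e.2
  vertex : ∀ e ∈ E, ∀ v ∈ V, x e.1 < x v → x v < x e.2 → height x y e (x v) ≠ y v
  cross : ∀ e ∈ E, ∀ f ∈ E, e.1 ≠ f.1 → e.2 ≠ f.2 → ∀ t, x e.1 < t → x f.1 < t → t < x e.2 →
    t < x f.2 → height x y e t ≠ height x y f t

variable {V : Finset ι} {E : Finset (ι × ι)} {x y : ι → ℝ}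

theorem height_fst (e : ι × ι) : height x y e (x e.1) = y e.1 := by simp [height]

namespace IsPlane

theorem height_snd (h : IsPlane V E x y) {e : ι × ι} (he : e ∈ E) :
    height x y e (x e.2) = y e.2 := by
  have := sub_pos.2 (h.lt e he)
  simp only [height, slope]
  field_simp
  ring

theorem eq_of_slope_eq (h : IsPlane V E x y) {e f : ι × ι} (he : e ∈ E) (hf : f ∈ E)
    (h1 : e.1 = f.1) (hs : slope x y e = slope x y f) : e = f := by
  have hh : ∀ t, height x y e t = height x y f t := fun t => by simp only [height, h1, hs]
  rcases lt_trichotomy (x e.2) (x f.2) with hlt | heq | hlt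
  · exact absurd ((hh _).symm.trans (h.height_snd he))
      (h.vertex f hf _ (h.snd_mem e he) (h1 ▸ h.lt e he) hlt)
  · exact Prod.ext h1 (h.inj (h.snd_mem e he) (h.snd_mem f hf) heq)
  · exact absurd ((hh _).trans (h.height_snd hf))
      (h.vertex e he _ (h.snd_mem f hf) (h1 ▸ h.lt f hf) hlt)

theorem eq_of_height_eq (h : IsPlane V E x y) {e f : ι × ι} (he : e ∈ E) (hf : f ∈ E) {t : ℝ}
    (h1 : x e.1 < t) (h2 : x f.1 < t) (h3 : t < x e.2) (h4 : t < x f.2)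
    (hh : height x y e t = height x y f t) : e = f := by
  by_cases e1 : e.1 = f.1
  · apply h.eq_of_slope_eq he hf e1
    have : t - x f.1 ≠ 0 := by linarith
    simp only [height, e1] at hh
    exact mul_right_cancel₀ this (by linarith)
  by_cases e2 : e.2 = f.2
  · -- the two segments lie on one line through their common right endpoint
    have hs : slope x y e = slope x y f := by
      have a1 := h.height_snd he
      have a2 := h.height_snd hf
      rw [e2] at a1
      have : t - x f.2 ≠ 0 := by linarith
      simp only [height] at a1 a2 hh
      exact mul_right_cancel₀ this (by linarith)
    have hall : ∀ s, height x y e s = height x y f s := by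
      intro s
      simp only [height, hs] at hh ⊢
      linarith
    rcases lt_trichotomy (x e.1) (x f.1) with hlt | heq | hlt
    · exact absurd ((hall _).trans (height_fst f))
        (h.vertex e he _ (h.fst_mem f hf) hlt (e2 ▸ h.lt f hf))
    · exact Prod.ext (h.inj (h.fst_mem e he) (h.fst_mem f hf) heq) e2
    · exact absurd ((hall _).symm.trans (height_fst e))
        (h.vertex f hf _ (h.fst_mem e he) hlt (e2 ▸ h.lt e he))
  exact absurd hh (h.cross e he f hf e1 e2 t h1 h2 h3 h4)

/-- `e` is the successor of `f` among the segments leaving a vertex to the right. -/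
def Consecutive (E : Finset (ι × ι)) (x y : ι → ℝ) (f e : ι × ι) : Prop :=
  f ∈ E ∧ e ∈ E ∧ f.1 = e.1 ∧ slope x y f < slope x y e ∧
    ∀ g ∈ E, g.1 = e.1 → ¬(slope x y f < slope x y g ∧ slope x y g < slope x y e)

theorem height_lt_height {f e : ι × ι} (h1 : f.1 = e.1) (hs : slope x y f < slope x y e) {t : ℝ}
    (ht : x e.1 < t) : height x y f t < height x y e t := by
  simp only [height, h1]
  have := mul_lt_mul_of_pos_right hs (sub_pos.2 ht)
  linarith

theorem height_le_of_no_crossing (h : IsPlane V E x y) {f g : ι × ι} (hf : f ∈ E) (hg : g ∈ E)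
    {m q : ℝ} (hmq : m < q) (h1 : x f.1 ≤ m) (h2 : x g.1 ≤ m) (h3 : q ≤ x f.2) (h4 : q ≤ x g.2)
    (hq : height x y f q < height x y g q) : height x y f m ≤ height x y g m := by
  by_contra! hm
  have hc : ContinuousOn (fun t => height x y g t - height x y f t) (Set.Icc m q) := by
    unfold height; fun_prop
  obtain ⟨t, ht, ht0⟩ := intermediate_value_Ioo hmq.le hc
    (show (0 : ℝ) ∈ Set.Ioo _ _ from ⟨by linarith, by linarith⟩)
  have := h.eq_of_height_eq hf hg (t := t) (by linarith [ht.1]) (by linarith [ht.1])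
    (by linarith [ht.2]) (by linarith [ht.2]) (by linarith)
  subst this
  exact lt_irrefl _ hq

theorem no_segment_between (h : IsPlane V E x y) {f e g : ι × ι} (hfe : Consecutive E x y f e)
    (hg : g ∈ E) {q : ℝ} (hq : x e.1 < q) (hqf : q ≤ x f.2) (hqe : q ≤ x e.2)
    (hreg : ∀ v ∈ V, x e.1 < x v → x v < q → height x y f (x v) ≤ y v →
      ¬ y v ≤ height x y e (x v))
    (h1 : x g.1 < q) (h2 : q < x g.2) (hlo : height x y f q < height x y g q)
    (hhi : height x y g q < height x y e q) : False := by
  obtain ⟨hf, he, h0, -, hcons⟩ := hfe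
  have lower := fun {m} (hm : m < q) (a : x e.1 ≤ m) (b : x g.1 ≤ m) =>
    h.height_le_of_no_crossing hf hg hm (h0 ▸ a) b hqf h2.le hlo
  have upper := fun {m} (hm : m < q) (a : x e.1 ≤ m) (b : x g.1 ≤ m) =>
    h.height_le_of_no_crossing hg he hm b a h2.le hqe hhi
  rcases lt_trichotomy (x e.1) (x g.1) with hlt | heq | hlt
  · have a := lower h1 hlt.le le_rfl
    have b := upper h1 hlt.le le_rfl
    rw [height_fst g] at a b
    exact hreg _ (h.fst_mem g hg) hlt h1 a b
  · have hge : g.1 = e.1 := (h.inj (h.fst_mem e he) (h.fst_mem g hg) heq).symm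
    have hpos := sub_pos.2 hq
    simp only [height, h0, hge] at hlo hhi
    exact hcons g hg hge ⟨lt_of_mul_lt_mul_right (by linarith) hpos.le,
      lt_of_mul_lt_mul_right (by linarith) hpos.le⟩
  · have a := lower hq le_rfl hlt.le
    have b := upper hq le_rfl hlt.le
    have c := height_fst (x := x) (y := y) f
    rw [h0] at c
    rw [height_fst e] at b
    exact h.vertex g hg _ (h.fst_mem e he) hlt (hq.trans h2) (le_antisymm b (c ▸ a))

/-- The segment `e` is the first one met going up from the vertex `w`. -/
def IsAbove (E : Finset (ι × ι)) (x y : ι → ℝ) (w : ι) (e : ι × ι) : Prop :=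
  (x e.1 < x w ∧ x w < x e.2 ∧ y w < height x y e (x w)) ∧
    ∀ g ∈ E, x g.1 < x w → x w < x g.2 → y w < height x y g (x w) →
      height x y e (x w) ≤ height x y g (x w)

/-- The segment `e` is the first one met going down from the vertex `w`. -/
def IsBelow (E : Finset (ι × ι)) (x y : ι → ℝ) (w : ι) (e : ι × ι) : Prop :=
  (x e.1 < x w ∧ x w < x e.2 ∧ height x y e (x w) < y w) ∧
    ∀ g ∈ E, x g.1 < x w → x w < x g.2 → height x y g (x w) < y w →
      height x y g (x w) ≤ height x y e (x w)

theorem exists_isAbove_or_isBelow (h : IsPlane V E x y) {f e : ι × ι}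
    (hfe : Consecutive E x y f e) : ∃ w ∈ V, IsAbove E x y w e ∨ IsBelow E x y w f := by
  have hfe' := hfe
  obtain ⟨hf, he, h0, hs, hcons⟩ := hfe'
  have hfe0 : x e.1 < x f.2 := h0 ▸ h.lt f hf
  -- the vertices in the closed triangular region between `f` and `e`
  let R := V.filter fun v => x e.1 < x v ∧ x v ≤ x f.2 ∧ x v ≤ x e.2 ∧
    height x y f (x v) ≤ y v ∧ y v ≤ height x y e (x v)
  have hR : R.Nonempty := by
    rcases le_total (x f.2) (x e.2) with hle | hle
    · refine ⟨f.2, Finset.mem_filter.2 ⟨h.snd_mem f hf, hfe0, le_rfl, hle,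
        (h.height_snd hf).le, ?_⟩⟩
      rw [← h.height_snd hf]
      exact (height_lt_height h0 hs hfe0).le
    · refine ⟨e.2, Finset.mem_filter.2 ⟨h.snd_mem e he, h.lt e he, hle, le_rfl, ?_,
        (h.height_snd he).ge⟩⟩
      rw [← h.height_snd he]
      exact (height_lt_height h0 hs (h.lt e he)).le
  obtain ⟨w, hwR, hmin⟩ := R.exists_min_image x hR
  obtain ⟨hw, w1, w2, w3, w4, w5⟩ := Finset.mem_filter.1 hwR
  have hreg : ∀ v ∈ V, x e.1 < x v → x v < x w → height x y f (x v) ≤ y v →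
      ¬ y v ≤ height x y e (x v) := fun v hv v1 v2 v3 v4 =>
    absurd (hmin v (Finset.mem_filter.2 ⟨hv, v1, by linarith, by linarith, v3, v4⟩)) (by linarith)
  refine ⟨w, hw, ?_⟩
  rcases w3.lt_or_eq with hlt | heq
  · left
    refine ⟨⟨w1, hlt, lt_of_le_of_ne w5 (h.vertex e he w hw w1 hlt).symm⟩,
      fun g hg g1 g2 g3 => ?_⟩
    by_contra! hlt'
    exact h.no_segment_between hfe hg w1 w2 w3 hreg g1 g2 (by linarith) hlt'
  · right
    obtain rfl : w = e.2 := h.inj hw (h.snd_mem e he) heq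
    have hlt : x e.2 < x f.2 := by
      refine lt_of_le_of_ne w2 fun heq' => ?_
      have : e = f := Prod.ext h0.symm (h.inj hw (h.snd_mem f hf) heq')
      subst this
      exact lt_irrefl _ hs
    refine ⟨⟨h0 ▸ w1, hlt, ?_⟩, fun g hg g1 g2 g3 => ?_⟩
    · exact lt_of_lt_of_eq (height_lt_height h0 hs w1) (h.height_snd he)
    by_contra! hlt'
    exact h.no_segment_between hfe hg w1 w2 w3 hreg g1 g2 hlt' (by rwa [h.height_snd he])

theorem exists_consecutive {e g : ι × ι} (he : e ∈ E) (hg : g ∈ E)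
    (h1 : g.1 = e.1) (hs : slope x y g < slope x y e) : ∃ f, Consecutive E x y f e := by
  obtain ⟨f, hf, hmax⟩ := (E.filter fun g => g.1 = e.1 ∧ slope x y g < slope x y e).exists_max_image
    (slope x y) ⟨g, Finset.mem_filter.2 ⟨hg, h1, hs⟩⟩
  obtain ⟨hfE, hf1, hfs⟩ := Finset.mem_filter.1 hf
  refine ⟨f, hfE, he, hf1, hfs, fun g hg hg1 ⟨a, b⟩ => ?_⟩
  exact absurd (hmax g (Finset.mem_filter.2 ⟨hg, hg1, b⟩)) (by linarith)

theorem consecutive_unique (h : IsPlane V E x y) {f e e' : ι × ι} (he : Consecutive E x y f e)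
    (he' : Consecutive E x y f e') : e = e' := by
  obtain ⟨-, he1, a1, a2, a3⟩ := he
  obtain ⟨-, he1', b1, b2, b3⟩ := he'
  refine h.eq_of_slope_eq he1 he1' (a1.symm.trans b1) ?_
  by_contra hne
  rcases lt_or_gt_of_ne hne with hlt | hlt
  · exact b3 e he1 (a1.symm.trans b1) ⟨a2, hlt⟩
  · exact a3 e' he1' (b1.symm.trans a1) ⟨b2, hlt⟩

theorem isAbove_unique (h : IsPlane V E x y) {w : ι} {e e' : ι × ι} (hE : e ∈ E) (hE' : e' ∈ E)
    (he : IsAbove E x y w e) (he' : IsAbove E x y w e') : e = e' :=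
  h.eq_of_height_eq hE hE' he.1.1 he'.1.1 he.1.2.1 he'.1.2.1
    (le_antisymm (he.2 e' hE' he'.1.1 he'.1.2.1 he'.1.2.2)
      (he'.2 e hE he.1.1 he.1.2.1 he.1.2.2))

theorem isBelow_unique (h : IsPlane V E x y) {w : ι} {e f : ι × ι} (hE : e ∈ E) (hF : f ∈ E)
    (he : IsBelow E x y w e) (hf : IsBelow E x y w f) : e = f :=
  h.eq_of_height_eq hE hF he.1.1 hf.1.1 he.1.2.1 hf.1.2.1
    (le_antisymm (hf.2 e hE he.1.1 he.1.2.1 he.1.2.2)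
      (he.2 f hF hf.1.1 hf.1.2.1 hf.1.2.2))

/-- A linear functional nonpositive at both endpoints is nonpositive along the segment. -/
theorem functional_height_nonpos (h : IsPlane V E x y) {e : ι × ι} (he : e ∈ E) {p : ι}
    (h1 : x e.1 < x p) (h2 : x p < x e.2) {α β : ℝ}
    (ha : α * (x e.1 - x p) + β * (y e.1 - y p) ≤ 0)
    (hb : α * (x e.2 - x p) + β * (y e.2 - y p) ≤ 0) :
    β * (height x y e (x p) - y p) ≤ 0 := by
  have hd : 0 < x e.2 - x e.1 := sub_pos.2 (h.lt e he)
  have hs : slope x y e * (x e.2 - x e.1) = y e.2 - y e.1 := div_mul_cancel₀ _ hd.ne'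
  have key : (x e.2 - x e.1) * (β * (height x y e (x p) - y p)) =
      (x e.2 - x p) * (α * (x e.1 - x p) + β * (y e.1 - y p)) +
        (x p - x e.1) * (α * (x e.2 - x p) + β * (y e.2 - y p)) := by
    simp only [height]
    linear_combination β * (x p - x e.1) * hs
  have : (x e.2 - x e.1) * (β * (height x y e (x p) - y p)) ≤ 0 := by
    rw [key]
    have := mul_nonpos_of_nonneg_of_nonpos (sub_nonneg.2 h2.le) ha
    have := mul_nonpos_of_nonneg_of_nonpos (sub_nonneg.2 h1.le) hb
    linarith
  by_contra! hpos
  linarith [mul_pos hd hpos]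

/-- A plane straight-line drawing on `n ≥ 2` vertices, at least `h` of which lie on the boundary of
the convex hull, has at most `3 n - 3 - h` segments. -/
theorem card_add_card_hull_le (h : IsPlane V E x y) (hV : 2 ≤ V.card) (P : Finset ι) (hP : P ⊆ V)
    (hsupp : ∀ p ∈ P, ∃ α β : ℝ, (α ≠ 0 ∨ β ≠ 0) ∧
      ∀ w ∈ V, α * (x w - x p) + β * (y w - y p) ≤ 0) :
    E.card + P.card + 3 ≤ 3 * V.card := by
  have hne : V.Nonempty := Finset.card_pos.1 (by omega)
  obtain ⟨l, hl, hlmin⟩ := V.exists_min_image x hne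
  obtain ⟨r, hr, hrmax⟩ := V.exists_max_image x hne
  have hlr : l ≠ r := by
    rintro rfl
    obtain ⟨a, ha, b, hb, hab⟩ := Finset.one_lt_card.1 hV
    have ea : x a = x l := le_antisymm (hrmax a ha) (hlmin a ha)
    have eb : x b = x l := le_antisymm (hrmax b hb) (hlmin b hb)
    exact hab (h.inj ha hb (ea.trans eb.symm))
  let M := E.filter fun e => ∃ g ∈ E, g.1 = e.1 ∧ slope x y g < slope x y e
  have hlow : (E \ M).card ≤ (V.erase r).card := by
    refine Finset.card_le_card_of_injOn Prod.fst ?_ ?_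
    · intro e he
      have he := (Finset.mem_sdiff.1 he).1
      refine Finset.mem_coe.2 (Finset.mem_erase.2 ⟨fun h1 => ?_, h.fst_mem e he⟩)
      have := h.lt e he
      rw [h1] at this
      linarith [hrmax _ (h.snd_mem e he)]
    · intro e he f hf hef
      obtain ⟨he, heM⟩ := Finset.mem_sdiff.1 he
      obtain ⟨hf, hfM⟩ := Finset.mem_sdiff.1 hf
      refine h.eq_of_slope_eq he hf hef (le_antisymm ?_ ?_)
      · by_contra! hlt
        exact heM (Finset.mem_filter.2 ⟨he, f, hf, hef.symm, hlt⟩)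
      · by_contra! hlt
        exact hfM (Finset.mem_filter.2 ⟨hf, e, he, hef, hlt⟩)
  have hpred : ∀ e : ι × ι, ∃ f, e ∈ M → Consecutive E x y f e := by
    intro e
    by_cases he : e ∈ M
    · obtain ⟨he, g, hg, h1, hs⟩ := Finset.mem_filter.1 he
      obtain ⟨f, hf⟩ := exists_consecutive he hg h1 hs
      exact ⟨f, fun _ => hf⟩
    · exact ⟨e, fun h => absurd h he⟩
  choose pred hpred using hpred
  have hslot : ∀ e : ι × ι, ∃ s : ι × Bool, e ∈ M → s.1 ∈ V ∧
      (s.2 = true → IsAbove E x y s.1 e) ∧ (s.2 = false → IsBelow E x y s.1 (pred e)) := by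
    intro e
    by_cases he : e ∈ M
    · obtain ⟨w, hw, hab | hbe⟩ := h.exists_isAbove_or_isBelow (hpred e he)
      · exact ⟨(w, true), fun _ => ⟨hw, fun _ => hab, by simp⟩⟩
      · exact ⟨(w, false), fun _ => ⟨hw, by simp, fun _ => hbe⟩⟩
    · exact ⟨(e.1, true), fun h => absurd h he⟩
  choose slot hslot using hslot
  have hinj : Set.InjOn slot M := by
    intro e he f hf hef
    have a := hslot e he
    have b := hslot f hf
    rw [← hef] at b
    have hpe := hpred e he
    have hpf := hpred f hf
    cases hc : (slot e).2
    · have := h.isBelow_unique hpe.1 hpf.1 (a.2.2 hc) (b.2.2 hc)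
      rw [← this] at hpf
      exact h.consecutive_unique hpe hpf
    · exact h.isAbove_unique hpe.2.1 hpf.2.1 (a.2.1 hc) (b.2.1 hc)
  -- each slot in use lies strictly between the extreme vertices
  have hspan : ∀ e ∈ M, ∃ g ∈ E, x g.1 < x (slot e).1 ∧ x (slot e).1 < x g.2 ∧
      ((slot e).2 = true → y (slot e).1 < height x y g (x (slot e).1)) ∧
      ((slot e).2 = false → height x y g (x (slot e).1) < y (slot e).1) := by
    intro e he
    have a := hslot e he
    have hpe := hpred e he
    cases hc : (slot e).2
    · have := (a.2.2 hc).1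
      exact ⟨pred e, hpe.1, this.1, this.2.1, by simp, fun _ => this.2.2⟩
    · have := (a.2.1 hc).1
      exact ⟨e, hpe.2.1, this.1, this.2.1, fun _ => this.2.2, by simp⟩
  have hfree : ∀ p : ι, ∃ b : Bool, p ∈ P \ {l, r} → ∀ e ∈ M, slot e ≠ (p, b) := by
    intro p
    by_cases hp : p ∈ P \ {l, r}
    · obtain ⟨hpP, hplr⟩ := Finset.mem_sdiff.1 hp
      simp only [Finset.mem_insert, Finset.mem_singleton, not_or] at hplr
      have hpV := hP hpP
      obtain ⟨α, β, hne0, hle⟩ := hsupp p hpP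
      have hβ : β ≠ 0 := by
        rintro rfl
        have hα : α ≠ 0 := by simpa using hne0
        have a := hle l hl
        have b := hle r hr
        rcases lt_or_gt_of_ne hα with hneg | hpos
        · exact hplr.1 (h.inj hpV hl (le_antisymm (by nlinarith) (hlmin p hpV)))
        · exact hplr.2 (h.inj hpV hr (le_antisymm (hrmax p hpV) (by nlinarith)))
      rcases lt_or_gt_of_ne hβ with hneg | hpos
      · refine ⟨false, fun _ e he hse => ?_⟩
        obtain ⟨g, hg, g1, g2, -, g3⟩ := hspan e he
        rw [hse] at g1 g2 g3
        have := h.functional_height_nonpos hg g1 g2 (hle _ (h.fst_mem g hg))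
          (hle _ (h.snd_mem g hg))
        nlinarith [g3 rfl]
      · refine ⟨true, fun _ e he hse => ?_⟩
        obtain ⟨g, hg, g1, g2, g3, -⟩ := hspan e he
        rw [hse] at g1 g2 g3
        have := h.functional_height_nonpos hg g1 g2 (hle _ (h.fst_mem g hg))
          (hle _ (h.snd_mem g hg))
        nlinarith [g3 rfl]
    · exact ⟨true, fun h => absurd h hp⟩
  choose free hfree using hfree
  let Q := (P \ {l, r}).image fun p => (p, free p)
  have hQ : Q.card = (P \ {l, r}).card :=
    Finset.card_image_of_injective _ fun p q hpq => congrArg Prod.fst hpq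
  have himg : M.image slot ⊆ ((V \ {l, r}) ×ˢ (Finset.univ : Finset Bool)) \ Q := by
    intro s hs
    obtain ⟨e, he, rfl⟩ := Finset.mem_image.1 hs
    obtain ⟨g, hg, g1, g2, -⟩ := hspan e he
    refine Finset.mem_sdiff.2 ⟨Finset.mem_product.2 ⟨Finset.mem_sdiff.2 ⟨(hslot e he).1, ?_⟩,
      Finset.mem_univ _⟩, fun hq => ?_⟩
    · simp only [Finset.mem_insert, Finset.mem_singleton, not_or]
      constructor
      · intro h0
        rw [h0] at g1
        linarith [hlmin _ (h.fst_mem g hg)]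
      · intro h0
        rw [h0] at g2
        linarith [hrmax _ (h.snd_mem g hg)]
    · obtain ⟨p, hp, hpe⟩ := Finset.mem_image.1 hq
      exact hfree p hp e he hpe.symm
  have hQsub : Q ⊆ (V \ {l, r}) ×ˢ (Finset.univ : Finset Bool) := by
    intro s hs
    obtain ⟨p, hp, rfl⟩ := Finset.mem_image.1 hs
    exact Finset.mem_product.2 ⟨Finset.sdiff_subset_sdiff hP le_rfl hp, Finset.mem_univ _⟩
  have hM := Finset.card_le_card himg
  rw [Finset.card_image_of_injOn hinj, Finset.card_sdiff_of_subset hQsub, Finset.card_product,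
    hQ, Finset.card_univ, Fintype.card_bool] at hM
  have hQle := Finset.card_le_card hQsub
  rw [Finset.card_product, hQ, Finset.card_univ, Fintype.card_bool] at hQle
  have hlrV : ({l, r} : Finset ι) ⊆ V := by
    intro z hz
    rcases Finset.mem_insert.1 hz with rfl | hz
    · exact hl
    · rwa [Finset.mem_singleton.1 hz]
  have hV2 := Finset.card_sdiff_of_subset hlrV
  rw [Finset.card_pair hlr] at hV2
  have hP2 : P.card ≤ (P \ {l, r}).card + 2 := by
    have := Finset.le_card_sdiff {l, r} P
    rw [Finset.card_pair hlr] at this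
    omega
  have hE := Finset.card_sdiff_add_card_eq_card (Finset.filter_subset
    (fun e => ∃ g ∈ E, g.1 = e.1 ∧ slope x y g < slope x y e) E)
  rw [Finset.card_erase_of_mem hr] at hlow
  change (E \ M).card + M.card = E.card at hE
  omega

end IsPlane

end PlaneDrawing

namespace Klein

/-- The combinatorial and metric data of an arrangement of circles inside the unit disc, none of
them surrounding another one, together with the circles orthogonal to the unit circle, seen in the
Klein model: the circle `s` has a pole `k s` and a weight `g s`, and the circle orthogonal to the
unit circle with centre `c` is the line `{x | x · c = 1}`. -/
structure Config (ι : Type*) where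
  k : ι → ℝ × ℝ
  g : ι → ℝ
  adj : ι → ι → Prop
  lines : Finset (ℝ × ℝ)
  g_pos : ∀ s, 0 < g s
  norm_lt : ∀ s, dot (k s) (k s) < 1
  one_sub_norm_lt : ∀ s, 1 - dot (k s) (k s) < g s ^ 2
  mul_le : ∀ s t, s ≠ t → g s * g t ≤ 1 - dot (k s) (k t)
  mul_eq : ∀ s t, adj s t → g s * g t = 1 - dot (k s) (k t)
  adj_symm : ∀ s t, adj s t → adj t s
  adj_ne : ∀ s t, adj s t → s ≠ t
  adj_side : ∀ s t, adj s t → ∀ c ∈ lines, ¬(dot (k s) c < 1 ∧ 1 < dot (k t) c)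
  one_lt : ∀ c ∈ lines, 1 < dot c c
  orth_or_disjoint : ∀ c ∈ lines, ∀ d ∈ lines, c ≠ d → OrthOrDisjoint c d

namespace Config

variable {ι : Type*} (G : Config ι)

/-- `z` is the point of the segment `k u`, `k w` with weights `s` and `t`. -/
def Comb (z : ℝ × ℝ) (u w : ι) (s t : ℝ) : Prop :=
  z.1 = s * (G.k u).1 + t * (G.k w).1 ∧ z.2 = s * (G.k u).2 + t * (G.k w).2

variable {G}

theorem Comb.dot {z : ℝ × ℝ} {u w : ι} {s t : ℝ} (h : G.Comb z u w s t) (v : ℝ × ℝ) :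
    dot z v = s * dot (G.k u) v + t * dot (G.k w) v := by
  simp only [Klein.dot, h.1, h.2]; ring

theorem Comb.one_sub_norm_lt {z : ℝ × ℝ} {u w : ι} {s t : ℝ} (h : G.Comb z u w s t)
    (huw : G.adj u w ∨ u = w) (hs : 0 < s) (ht : 0 ≤ t) (hst : s + t = 1) :
    1 - Klein.dot z z < (s * G.g u + t * G.g w) ^ 2 := by
  have e : 1 - Klein.dot z z = s ^ 2 * (1 - Klein.dot (G.k u) (G.k u)) +
      2 * s * t * (1 - Klein.dot (G.k u) (G.k w)) + t ^ 2 * (1 - Klein.dot (G.k w) (G.k w)) := by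
    rw [h.dot, dot_comm _ z, dot_comm _ z, h.dot, h.dot, dot_comm (G.k w) (G.k u)]
    linear_combination (-(s + t + 1)) * hst
  rw [e]
  have h1 := mul_lt_mul_of_pos_left (G.one_sub_norm_lt u) (pow_pos hs 2)
  have h2 := mul_le_mul_of_nonneg_left (G.one_sub_norm_lt w).le (sq_nonneg t)
  have h3 : 2 * s * t * (1 - Klein.dot (G.k u) (G.k w)) ≤ 2 * s * t * (G.g u * G.g w) := by
    refine mul_le_mul_of_nonneg_left ?_ (by positivity)
    rcases huw with huw | rfl
    · exact (G.mul_eq u w huw).ge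
    · have := G.one_sub_norm_lt u
      rw [pow_two] at this
      exact this.le
  nlinarith

theorem Comb.mul_le_one_sub_norm {z : ℝ × ℝ} {u w p q : ι} {s t a b : ℝ} (h : G.Comb z u w s t)
    (h' : G.Comb z p q a b) (hs : 0 ≤ s) (ht : 0 ≤ t) (ha : 0 ≤ a) (hb : 0 ≤ b) (hst : s + t = 1)
    (hab : a + b = 1) (hup : u ≠ p) (huq : u ≠ q) (hwp : w ≠ p) (hwq : w ≠ q) :
    (s * G.g u + t * G.g w) * (a * G.g p + b * G.g q) ≤ 1 - Klein.dot z z := by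
  have e : 1 - Klein.dot z z = s * a * (1 - Klein.dot (G.k u) (G.k p)) +
      s * b * (1 - Klein.dot (G.k u) (G.k q)) + t * a * (1 - Klein.dot (G.k w) (G.k p)) +
      t * b * (1 - Klein.dot (G.k w) (G.k q)) := by
    rw [h.dot, dot_comm _ z, dot_comm _ z, h'.dot, h'.dot, dot_comm (G.k p), dot_comm (G.k q),
      dot_comm (G.k p), dot_comm (G.k q)]
    linear_combination (-(a + b)) * hst - hab
  rw [e]
  have h1 := mul_le_mul_of_nonneg_left (G.mul_le u p hup) (mul_nonneg hs ha)
  have h2 := mul_le_mul_of_nonneg_left (G.mul_le u q huq) (mul_nonneg hs hb)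
  have h3 := mul_le_mul_of_nonneg_left (G.mul_le w p hwp) (mul_nonneg ht ha)
  have h4 := mul_le_mul_of_nonneg_left (G.mul_le w q hwq) (mul_nonneg ht hb)
  linarith

/-- Segments joining adjacent poles, or single poles, without a common vertex are disjoint. -/
theorem Comb.false_of_disjoint {z : ℝ × ℝ} {u w p q : ι} {s t a b : ℝ} (h : G.Comb z u w s t)
    (h' : G.Comb z p q a b) (huw : G.adj u w ∨ u = w) (hpq : G.adj p q ∨ p = q)
    (hs : 0 < s) (ht : 0 ≤ t) (ha : 0 < a) (hb : 0 ≤ b) (hst : s + t = 1)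
    (hab : a + b = 1) (hup : u ≠ p) (huq : u ≠ q) (hwp : w ≠ p) (hwq : w ≠ q) : False := by
  have h1 := h.one_sub_norm_lt huw hs ht hst
  have h2 := h'.one_sub_norm_lt hpq ha hb hab
  have h3 := h.mul_le_one_sub_norm h' hs.le ht ha.le hb hst hab hup huq hwp hwq
  have p1 : 0 < s * G.g u + t * G.g w :=
    add_pos_of_pos_of_nonneg (mul_pos hs (G.g_pos u)) (mul_nonneg ht (G.g_pos w).le)
  have p2 : 0 < a * G.g p + b * G.g q :=
    add_pos_of_pos_of_nonneg (mul_pos ha (G.g_pos p)) (mul_nonneg hb (G.g_pos q).le)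
  nlinarith

theorem comb_self (v : ι) : G.Comb (G.k v) v v 1 0 := by simp [Comb]

variable (G) in
theorem k_injective : Function.Injective G.k := by
  intro u v huv
  by_contra hne
  have h : G.Comb (G.k u) v v 1 0 := huv ▸ comb_self v
  exact (comb_self u).false_of_disjoint h (.inr rfl) (.inr rfl) one_pos le_rfl one_pos le_rfl
    (by norm_num) (by norm_num) hne hne hne hne

theorem Comb.false_of_vertex {u w v : ι} {s t : ℝ} (h : G.Comb (G.k v) u w s t)
    (huw : G.adj u w) (hs : 0 < s) (ht : 0 < t) (hst : s + t = 1) : False := by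
  have hne : ∀ {a b : ι} {s t : ℝ}, G.Comb (G.k v) a b s t → a ≠ b → s + t = 1 → 0 < t →
      a ≠ v := by
    rintro a b s t h hab hst ht rfl
    refine hab (G.k_injective (Prod.ext ?_ ?_))
    · apply mul_left_cancel₀ ht.ne'
      linear_combination h.1 + (G.k a).1 * hst
    · apply mul_left_cancel₀ ht.ne'
      linear_combination h.2 + (G.k a).2 * hst
  have h1 := hne h (G.adj_ne u w huw) hst ht
  have h2 := hne (a := w) (b := u) (s := t) (t := s)
    ⟨by rw [h.1]; ring, by rw [h.2]; ring⟩ (G.adj_ne u w huw).symm (by linarith) hs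
  exact h.false_of_disjoint (comb_self v) (.inl huw) (.inr rfl) hs ht.le one_pos le_rfl hst
    (by norm_num) h1 h1 h2 h2

/-- Poles on the two sides of a right angle whose corner is a pole are not adjacent. -/
theorem not_adj_of_corner {c d : ℝ × ℝ} (hc : c ∈ G.lines) (hd : d ∈ G.lines) (h : dot c d = 1)
    {z a b : ι} (hzc : dot (G.k z) c = 1) (hzd : dot (G.k z) d = 1) (hac : dot (G.k a) c = 1)
    (hbd : dot (G.k b) d = 1) (haz : a ≠ z) (hbz : b ≠ z) : ¬G.adj a b := by
  intro hab
  have e := mul_corner_identity (G.one_lt c hc) (G.one_lt d hd) h hzc hzd hac hbd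
  rw [← G.mul_eq a b hab] at e
  have h1 := mul_lt_mul_of_pos_left (G.one_sub_norm_lt z) (mul_pos (G.g_pos a) (G.g_pos b))
  have h2 := mul_le_mul (G.mul_le a z haz) (G.mul_le b z hbz)
    (mul_pos (G.g_pos b) (G.g_pos z)).le
    ((mul_pos (G.g_pos a) (G.g_pos z)).le.trans (G.mul_le a z haz))
  nlinarith

theorem dot_eq_one_of_mem {c d : ℝ × ℝ} (hc : c ∈ G.lines) (hd : d ∈ G.lines) (hne : c ≠ d) {v : ι}
    (hvc : dot (G.k v) c = 1) (hvd : dot (G.k v) d = 1) : dot c d = 1 :=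
  dot_eq_one_of_common_point (G.orth_or_disjoint c hc d hd hne) (G.norm_lt v) hvc hvd

/-- Two orthogonal lines have at most one pole in common. -/
theorem eq_of_mem_of_mem {c d : ℝ × ℝ} (hc : c ∈ G.lines) (hd : d ∈ G.lines) (hne : c ≠ d)
    {v w : ι} (hvc : dot (G.k v) c = 1) (hvd : dot (G.k v) d = 1) (hwc : dot (G.k w) c = 1)
    (hwd : dot (G.k w) d = 1) : v = w := by
  have hcd := dot_eq_one_of_mem hc hd hne hvc hvd
  have h1 := G.one_lt c hc
  have h2 := G.one_lt d hd
  obtain ⟨s, hs1, hs2⟩ := exists_eq_add_rotate (by linarith) (hvc.trans hwc.symm)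
  have hdet : c.1 * d.2 - c.2 * d.1 ≠ 0 := by
    intro h0
    have : (c.1 * d.2 - c.2 * d.1) ^ 2 = dot c c * dot d d - dot c d ^ 2 := by
      simp only [dot]; ring
    rw [h0, hcd] at this
    nlinarith
  have hs : s = 0 := by
    have : s * (c.1 * d.2 - c.2 * d.1) = 0 := by
      simp only [dot] at hvd hwd
      rw [hs1, hs2] at hvd
      linear_combination hvd - hwd
    exact (mul_eq_zero.1 this).resolve_right hdet
  exact G.k_injective (Prod.ext (by rw [hs1, hs]; ring) (by rw [hs2, hs]; ring))

variable (G) in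
/-- The lines of `L` through the pole of `v`. -/
noncomputable def through (L : Finset (ℝ × ℝ)) (v : ι) : Finset (ℝ × ℝ) :=
  L.filter fun c => dot (G.k v) c = 1

theorem mem_through {L : Finset (ℝ × ℝ)} {v : ι} {c : ℝ × ℝ} :
    c ∈ G.through L v ↔ c ∈ L ∧ dot (G.k v) c = 1 := Finset.mem_filter

theorem card_through_lines_le (v : ι) : (G.through G.lines v).card ≤ 2 := by
  by_contra! h
  obtain ⟨a, ha, b, hb, c, hc, hab, hac, hbc⟩ := Finset.two_lt_card.1 h
  rw [mem_through] at ha hb hc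
  exact not_pairwise_orth (G.one_lt a ha.1) (G.one_lt b hb.1) (G.one_lt c hc.1)
    (dot_eq_one_of_mem ha.1 hb.1 hab ha.2 hb.2) (dot_eq_one_of_mem hb.1 hc.1 hbc hb.2 hc.2)
    (dot_eq_one_of_mem ha.1 hc.1 hac ha.2 hc.2)

variable (G) in
/-- All poles of `V` lie on one closed side of the line `c`. -/
def Supports (V : Finset ι) (c : ℝ × ℝ) : Prop :=
  (∀ v ∈ V, dot (G.k v) c ≤ 1) ∨ ∀ v ∈ V, 1 ≤ dot (G.k v) c

theorem Supports.mono {V W : Finset ι} {c : ℝ × ℝ} (h : G.Supports V c) (hWV : W ⊆ V) :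
    G.Supports W c :=
  h.imp (fun h v hv => h v (hWV hv)) fun h v hv => h v (hWV hv)

theorem Supports.mul_nonneg {V : Finset ι} {c : ℝ × ℝ} (h : G.Supports V c) {v w : ι}
    (hv : v ∈ V) (hw : w ∈ V) : 0 ≤ (dot (G.k v) c - 1) * (dot (G.k w) c - 1) := by
  rcases h with h | h
  · exact mul_nonneg_of_nonpos_of_nonpos (by linarith [h v hv]) (by linarith [h w hw])
  · exact _root_.mul_nonneg (by linarith [h v hv]) (by linarith [h w hw])

/-- Three lines with a common perpendicular which carry poles `x`, `y`, `z` do not all have the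
poles of the other two on one side. -/
theorem not_three_perp {l a b c : ℝ × ℝ} {x y z : ι} (hl : l ∈ G.lines) (ha : a ∈ G.lines)
    (hb : b ∈ G.lines) (hc : c ∈ G.lines) (hab : a ≠ b) (hac : a ≠ c) (hbc : b ≠ c)
    (hla : dot l a = 1) (hlb : dot l b = 1) (hlc : dot l c = 1)
    (hxa : dot (G.k x) a = 1) (hyb : dot (G.k y) b = 1) (hzc : dot (G.k z) c = 1)
    (h1 : 0 ≤ (dot (G.k y) a - 1) * (dot (G.k z) a - 1))
    (h2 : 0 ≤ (dot (G.k x) b - 1) * (dot (G.k z) b - 1))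
    (h3 : 0 ≤ (dot (G.k x) c - 1) * (dot (G.k y) c - 1)) : False :=
  not_three_mutually_supporting (G.one_lt l hl) (G.one_lt a ha) (G.one_lt b hb) (G.one_lt c hc)
    hla hlb hlc (G.orth_or_disjoint a ha b hb hab) (G.orth_or_disjoint a ha c hc hac)
    (G.orth_or_disjoint b hb c hc hbc) (G.norm_lt x) (G.norm_lt y) (G.norm_lt z) hxa hyb hzc
    h1 h2 h3

/-- A line has at most two perpendiculars among the occupied supporting lines. -/
theorem card_perp_le {V : Finset ι} {l : ℝ × ℝ} (hl : l ∈ G.lines) {T : Finset (ℝ × ℝ)}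
    (hT : T ⊆ G.lines) (hperp : ∀ c ∈ T, dot l c = 1) (hsupp : ∀ c ∈ T, G.Supports V c)
    (hocc : ∀ c ∈ T, ∃ v ∈ V, dot (G.k v) c = 1) : T.card ≤ 2 := by
  by_contra! h
  obtain ⟨a, ha, b, hb, c, hc, hab, hac, hbc⟩ := Finset.two_lt_card.1 h
  obtain ⟨x, hx, hxa⟩ := hocc a ha
  obtain ⟨y, hy, hyb⟩ := hocc b hb
  obtain ⟨z, hz, hzc⟩ := hocc c hc
  exact not_three_perp hl (hT ha) (hT hb) (hT hc) hab hac hbc (hperp a ha) (hperp b hb)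
    (hperp c hc) hxa hyb hzc ((hsupp a ha).mul_nonneg hy hz) ((hsupp b hb).mul_nonneg hx hz)
    ((hsupp c hc).mul_nonneg hx hy)

end Config

/-- The ordered pairs of orthogonal lines of `L`. -/
noncomputable def orthPairs (L : Finset (ℝ × ℝ)) : Finset ((ℝ × ℝ) × (ℝ × ℝ)) :=
  (L ×ˢ L).filter fun p => dot p.1 p.2 = 1

/-- The lines of `L` orthogonal to `b`. -/
noncomputable def perps (L : Finset (ℝ × ℝ)) (b : ℝ × ℝ) : Finset (ℝ × ℝ) :=
  L.filter fun c => dot b c = 1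

theorem mem_perps {L : Finset (ℝ × ℝ)} {b c : ℝ × ℝ} : c ∈ perps L b ↔ c ∈ L ∧ dot b c = 1 :=
  Finset.mem_filter

theorem mem_orthPairs {L : Finset (ℝ × ℝ)} {p : (ℝ × ℝ) × (ℝ × ℝ)} :
    p ∈ orthPairs L ↔ (p.1 ∈ L ∧ p.2 ∈ L) ∧ dot p.1 p.2 = 1 := by
  rw [orthPairs, Finset.mem_filter, Finset.mem_product]

theorem card_orthPairs (L : Finset (ℝ × ℝ)) :
    (orthPairs L).card = ∑ c ∈ L, (perps L c).card := by
  simp only [orthPairs, perps, Finset.card_filter, Finset.sum_product]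

theorem card_orthPairs_insert {L : Finset (ℝ × ℝ)} {b : ℝ × ℝ} (hb : b ∉ L) :
    (orthPairs L).card + 2 * (perps L b).card ≤ (orthPairs (insert b L)).card := by
  have h1 : ∀ c ∈ L, (perps L c).card + (if dot b c = 1 then 1 else 0) =
      (perps (insert b L) c).card := by
    intro c _
    rw [perps, perps, Finset.filter_insert]
    by_cases h : dot b c = 1
    · rw [if_pos h, if_pos (by rwa [dot_comm]), Finset.card_insert_of_notMem]
      exact fun h' => hb (Finset.mem_filter.1 h').1
    · rw [if_neg h, if_neg (by rwa [dot_comm]), add_zero]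
  rw [card_orthPairs, card_orthPairs, Finset.sum_insert hb, ← Finset.sum_congr rfl h1,
    Finset.sum_add_distrib, ← Finset.card_filter]
  have : (perps L b).card ≤ (perps (insert b L) b).card :=
    Finset.card_le_card (Finset.filter_subset_filter _ (Finset.subset_insert b L))
  change (∑ c ∈ L, (perps L c).card) + 2 * (perps L b).card ≤ (perps (insert b L) b).card +
    (∑ c ∈ L, (perps L c).card + (perps L b).card)
  omega

namespace Config

variable {ι : Type*} (G : Config ι)

/-- Vertices `V` cut out by occupied supporting lines `L`. -/
structure IsRegion (V : Finset ι) (L : Finset (ℝ × ℝ)) : Prop where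
  subset : L ⊆ G.lines
  supports : ∀ c ∈ L, G.Supports V c
  occupied : ∀ c ∈ L, ∃ v ∈ V, dot (G.k v) c = 1

/-- The poles of `u` and `w` lie on a common line of `L`. -/
def SharesLine (L : Finset (ℝ × ℝ)) (u w : ι) : Prop :=
  ∃ c ∈ L, dot (G.k u) c = 1 ∧ dot (G.k w) c = 1

/-- The contribution of a vertex to the potential, halved for every line of `L` through it. -/
noncomputable def vertexWeight (L : Finset (ℝ × ℝ)) (v : ι) : ℝ :=
  (1 / 2) ^ (G.through L v).card * (196 - 44 * (G.through G.lines v).card)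

/-- The contribution of an ordered pair to the potential, halved along the lines of `L`. -/
noncomputable def edgeWeight (L : Finset (ℝ × ℝ)) (u w : ι) : ℝ :=
  if G.adj u w then if G.SharesLine L u w then 11 else 22 else 0

/-- The potential of a region: contributions of vertices and edges, those on the boundary being
shared with the neighbouring regions, and a correction for the shape of the boundary. -/
noncomputable def potential (V : Finset ι) (L : Finset (ℝ × ℝ)) : ℝ :=
  ∑ v ∈ V, G.vertexWeight L v - ∑ u ∈ V, ∑ w ∈ V, G.edgeWeight L u w +
    53 * (2 * (L.card : ℝ) - ((orthPairs L).card : ℝ) / 2 - 4)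

/-- The lines of `L` carrying a pole of `W`. -/
noncomputable def restrict (L : Finset (ℝ × ℝ)) (W : Finset ι) : Finset (ℝ × ℝ) :=
  L.filter fun c => ∃ v ∈ W, dot (G.k v) c = 1

variable {G}

theorem mem_restrict {L : Finset (ℝ × ℝ)} {W : Finset ι} {c : ℝ × ℝ} :
    c ∈ G.restrict L W ↔ c ∈ L ∧ ∃ v ∈ W, dot (G.k v) c = 1 := Finset.mem_filter

theorem IsRegion.insert_restrict {V W : Finset ι} {L : Finset (ℝ × ℝ)} (h : G.IsRegion V L)
    (hWV : W ⊆ V) {b : ℝ × ℝ} (hb : b ∈ G.lines) (hs : G.Supports W b)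
    (ho : ∃ v ∈ W, dot (G.k v) b = 1) : G.IsRegion W (insert b (G.restrict L W)) where
  subset := Finset.insert_subset hb ((Finset.filter_subset _ _).trans h.subset)
  supports c hc := by
    rcases Finset.mem_insert.1 hc with rfl | hc
    · exact hs
    · exact (h.supports c (mem_restrict.1 hc).1).mono hWV
  occupied c hc := by
    rcases Finset.mem_insert.1 hc with rfl | hc
    · exact ho
    · exact (mem_restrict.1 hc).2

theorem vertexWeight_of_ne {L : Finset (ℝ × ℝ)} {W : Finset ι} {b : ℝ × ℝ} {v : ι} (hv : v ∈ W)
    (hvb : dot (G.k v) b ≠ 1) :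
    G.vertexWeight (insert b (G.restrict L W)) v = G.vertexWeight L v := by
  have : G.through (insert b (G.restrict L W)) v = G.through L v := by
    ext c
    rw [mem_through, mem_through, Finset.mem_insert, mem_restrict]
    constructor
    · rintro ⟨rfl | h, h'⟩
      · exact absurd h' hvb
      · exact ⟨h.1, h'⟩
    · rintro ⟨h, h'⟩
      exact ⟨.inr ⟨h, v, hv, h'⟩, h'⟩
  rw [vertexWeight, vertexWeight, this]

theorem vertexWeight_of_eq {L : Finset (ℝ × ℝ)} {W : Finset ι} {b : ℝ × ℝ} {v : ι} (hv : v ∈ W)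
    (hb : b ∉ L) (hvb : dot (G.k v) b = 1) :
    G.vertexWeight (insert b (G.restrict L W)) v = G.vertexWeight L v / 2 := by
  have : G.through (insert b (G.restrict L W)) v = insert b (G.through L v) := by
    ext c
    rw [mem_through, Finset.mem_insert, Finset.mem_insert, mem_through, mem_restrict]
    constructor
    · rintro ⟨rfl | h, h'⟩
      · exact .inl rfl
      · exact .inr ⟨h.1, h'⟩
    · rintro (rfl | ⟨h, h'⟩)
      · exact ⟨.inl rfl, hvb⟩
      · exact ⟨.inr ⟨h, v, hv, h'⟩, h'⟩
  rw [vertexWeight, vertexWeight, this,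
    Finset.card_insert_of_notMem fun h => hb (mem_through.1 h).1, pow_succ]
  ring

theorem edgeWeight_le_of_not_both {L : Finset (ℝ × ℝ)} {W : Finset ι} {b : ℝ × ℝ} {u w : ι}
    (h : ¬(dot (G.k u) b = 1 ∧ dot (G.k w) b = 1)) :
    G.edgeWeight L u w ≤ G.edgeWeight (insert b (G.restrict L W)) u w := by
  unfold edgeWeight
  by_cases hadj : G.adj u w
  · rw [if_pos hadj, if_pos hadj]
    by_cases h1 : G.SharesLine (insert b (G.restrict L W)) u w
    · have : G.SharesLine L u w := by
        obtain ⟨c, hc, hu, hw⟩ := h1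
        rcases Finset.mem_insert.1 hc with rfl | hc
        · exact absurd ⟨hu, hw⟩ h
        · exact ⟨c, (mem_restrict.1 hc).1, hu, hw⟩
      rw [if_pos h1, if_pos this]
    · rw [if_neg h1]
      split_ifs <;> norm_num
  · rw [if_neg hadj, if_neg hadj]

theorem edgeWeight_nonneg (L : Finset (ℝ × ℝ)) (u w : ι) : 0 ≤ G.edgeWeight L u w := by
  unfold edgeWeight
  split_ifs <;> norm_num

theorem sum_vertexWeight_cut {V : Finset ι} {L : Finset (ℝ × ℝ)} {b : ℝ × ℝ} (hb : b ∉ L) :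
    ∑ v ∈ V.filter (fun v => 1 ≤ dot (G.k v) b),
        G.vertexWeight (insert b (G.restrict L (V.filter fun v => 1 ≤ dot (G.k v) b))) v +
      ∑ v ∈ V.filter (fun v => dot (G.k v) b ≤ 1),
        G.vertexWeight (insert b (G.restrict L (V.filter fun v => dot (G.k v) b ≤ 1))) v =
    ∑ v ∈ V, G.vertexWeight L v := by
  rw [Finset.sum_filter, Finset.sum_filter, ← Finset.sum_add_distrib]
  refine Finset.sum_congr rfl fun v hv => ?_
  rcases lt_trichotomy (dot (G.k v) b) 1 with hlt | heq | hlt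
  · rw [if_neg (not_le.2 hlt), if_pos hlt.le,
      vertexWeight_of_ne (Finset.mem_filter.2 ⟨hv, hlt.le⟩) hlt.ne, zero_add]
  · rw [if_pos heq.ge, if_pos heq.le, vertexWeight_of_eq (Finset.mem_filter.2 ⟨hv, heq.ge⟩) hb heq,
      vertexWeight_of_eq (Finset.mem_filter.2 ⟨hv, heq.le⟩) hb heq, add_halves]
  · rw [if_neg (not_le.2 hlt), if_pos hlt.le,
      vertexWeight_of_ne (Finset.mem_filter.2 ⟨hv, hlt.le⟩) hlt.ne', add_zero]

theorem sum_sum_filter (V : Finset ι) (p : ι → Prop) (f : ι → ι → ℝ) :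
    ∑ u ∈ V.filter p, ∑ w ∈ V.filter p, f u w =
      ∑ u ∈ V, ∑ w ∈ V, if p u ∧ p w then f u w else 0 := by
  rw [Finset.sum_filter]
  refine Finset.sum_congr rfl fun u _ => ?_
  by_cases h : p u
  · simp only [h, if_true, true_and, Finset.sum_filter]
  · simp only [h, if_false, false_and, Finset.sum_const_zero]

theorem sum_edgeWeight_cut {V : Finset ι} {L : Finset (ℝ × ℝ)} {b : ℝ × ℝ} (hb : b ∈ G.lines) :
    ∑ u ∈ V, ∑ w ∈ V, G.edgeWeight L u w ≤
    ∑ u ∈ V.filter (fun v => 1 ≤ dot (G.k v) b), ∑ w ∈ V.filter (fun v => 1 ≤ dot (G.k v) b),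
        G.edgeWeight (insert b (G.restrict L (V.filter fun v => 1 ≤ dot (G.k v) b))) u w +
      ∑ u ∈ V.filter (fun v => dot (G.k v) b ≤ 1), ∑ w ∈ V.filter (fun v => dot (G.k v) b ≤ 1),
        G.edgeWeight (insert b (G.restrict L (V.filter fun v => dot (G.k v) b ≤ 1))) u w := by
  rw [sum_sum_filter, sum_sum_filter, ← Finset.sum_add_distrib]
  refine Finset.sum_le_sum fun u _ => ?_
  rw [← Finset.sum_add_distrib]
  refine Finset.sum_le_sum fun w _ => ?_
  by_cases hboth : dot (G.k u) b = 1 ∧ dot (G.k w) b = 1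
  · rw [if_pos ⟨hboth.1.ge, hboth.2.ge⟩, if_pos ⟨hboth.1.le, hboth.2.le⟩]
    have h1 : ∀ M, G.edgeWeight (insert b M) u w = if G.adj u w then 11 else 0 := fun M => by
      have : G.SharesLine (insert b M) u w := ⟨b, Finset.mem_insert_self _ _, hboth⟩
      rw [edgeWeight, if_pos this]
    rw [h1, h1, edgeWeight]
    split_ifs <;> norm_num
  by_cases hadj : G.adj u w
  · have hside : (1 ≤ dot (G.k u) b ∧ 1 ≤ dot (G.k w) b) ∨
        (dot (G.k u) b ≤ 1 ∧ dot (G.k w) b ≤ 1) := by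
      have h1 := G.adj_side u w hadj b hb
      have h2 := G.adj_side w u (G.adj_symm u w hadj) b hb
      by_contra! hcon
      rcases lt_or_ge (dot (G.k u) b) 1 with h | h
      · exact h1 ⟨h, hcon.2 h.le⟩
      · have := hcon.1 h
        exact h2 ⟨this, not_le.1 fun hle => by linarith [hcon.2 hle]⟩
    rcases hside with h | h
    · rw [if_pos h]
      refine (edgeWeight_le_of_not_both hboth).trans (le_add_of_nonneg_right ?_)
      split_ifs
      · exact edgeWeight_nonneg _ _ _
      · exact le_rfl
    · rw [if_pos h]
      refine (edgeWeight_le_of_not_both hboth).trans (le_add_of_nonneg_left ?_)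
      split_ifs
      · exact edgeWeight_nonneg _ _ _
      · exact le_rfl
  · have h0 : ∀ M, G.edgeWeight M u w = 0 := fun M => if_neg hadj
    simp only [h0, ite_self, add_zero, le_refl]

/-- Two lines of a region orthogonal to a perpendicular of `b` and carrying poles on the same side
of `b` coincide. -/
theorem IsRegion.perp_unique {V : Finset ι} {L : Finset (ℝ × ℝ)} (h : G.IsRegion V L)
    {a b c d : ℝ × ℝ} (hb : b ∈ G.lines) (hbL : b ∉ L) (ha : a ∈ L) (hc : c ∈ L) (hd : d ∈ L)
    (hab : dot a b = 1) (hac : dot a c = 1) (had : dot a d = 1) {x y z : ι} (hx : x ∈ V)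
    (hxb : dot (G.k x) b = 1) (hy : y ∈ V) (hyc : dot (G.k y) c = 1) (hz : z ∈ V)
    (hzd : dot (G.k z) d = 1) (hside : 0 ≤ (dot (G.k y) b - 1) * (dot (G.k z) b - 1)) : c = d := by
  by_contra hcd
  exact not_three_perp (h.subset ha) hb (h.subset hc) (h.subset hd)
    (fun e => hbL (e ▸ hc)) (fun e => hbL (e ▸ hd)) hcd hab hac had hxb hyc hzd hside
    ((h.supports c hc).mul_nonneg hx hz) ((h.supports d hd).mul_nonneg hx hy)

/-- Cutting a region along a line does not increase the boundary term. -/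
theorem IsRegion.boundary_cut {V : Finset ι} {L : Finset (ℝ × ℝ)} (h : G.IsRegion V L) {b : ℝ × ℝ}
    (hb : b ∈ G.lines) (hbL : b ∉ L) (ho : ∃ v ∈ V, dot (G.k v) b = 1) :
    4 * ((insert b (G.restrict L (V.filter fun v => 1 ≤ dot (G.k v) b))).card +
        (insert b (G.restrict L (V.filter fun v => dot (G.k v) b ≤ 1))).card) +
      (orthPairs L).card ≤ 4 * L.card + 8 +
      (orthPairs (insert b (G.restrict L (V.filter fun v => 1 ≤ dot (G.k v) b)))).card +
      (orthPairs (insert b (G.restrict L (V.filter fun v => dot (G.k v) b ≤ 1)))).card := by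
  obtain ⟨x, hx, hxb⟩ := ho
  set A := G.restrict L (V.filter fun v => 1 ≤ dot (G.k v) b) with hA
  set D := G.restrict L (V.filter fun v => dot (G.k v) b ≤ 1) with hD
  have hAL : A ⊆ L := Finset.filter_subset _ _
  have hDL : D ⊆ L := Finset.filter_subset _ _
  have memA : ∀ {c}, c ∈ A → ∃ v ∈ V, 1 ≤ dot (G.k v) b ∧ dot (G.k v) c = 1 := by
    intro c hc
    obtain ⟨v, hv, hvc⟩ := (mem_restrict.1 hc).2
    exact ⟨v, (Finset.mem_filter.1 hv).1, (Finset.mem_filter.1 hv).2, hvc⟩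
  have memD : ∀ {c}, c ∈ D → ∃ v ∈ V, dot (G.k v) b ≤ 1 ∧ dot (G.k v) c = 1 := by
    intro c hc
    obtain ⟨v, hv, hvc⟩ := (mem_restrict.1 hc).2
    exact ⟨v, (Finset.mem_filter.1 hv).1, (Finset.mem_filter.1 hv).2, hvc⟩
  have memAD : ∀ {c}, c ∈ A \ D → c ∈ L ∧ ∃ v ∈ V, 1 < dot (G.k v) b ∧ dot (G.k v) c = 1 := by
    intro c hc
    obtain ⟨hcA, hcD⟩ := Finset.mem_sdiff.1 hc
    obtain ⟨v, hv, hvb, hvc⟩ := memA hcA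
    refine ⟨hAL hcA, v, hv, lt_of_not_ge fun hle => hcD ?_, hvc⟩
    exact mem_restrict.2 ⟨hAL hcA, v, Finset.mem_filter.2 ⟨hv, hle⟩, hvc⟩
  have memDA : ∀ {c}, c ∈ D \ A → c ∈ L ∧ ∃ v ∈ V, dot (G.k v) b < 1 ∧ dot (G.k v) c = 1 := by
    intro c hc
    obtain ⟨hcD, hcA⟩ := Finset.mem_sdiff.1 hc
    obtain ⟨v, hv, hvb, hvc⟩ := memD hcD
    refine ⟨hDL hcD, v, hv, lt_of_not_ge fun hle => hcA ?_, hvc⟩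
    exact mem_restrict.2 ⟨hDL hcD, v, Finset.mem_filter.2 ⟨hv, hle⟩, hvc⟩
  have hdis : ∀ {c}, c ∈ L → OrthOrDisjoint b c := fun {c} hc =>
    G.orth_or_disjoint b hb c (h.subset hc) fun e => hbL (e ▸ hc)
  have hcover : A ∪ D = L := by
    refine Finset.Subset.antisymm (Finset.union_subset hAL hDL) fun c hc => ?_
    obtain ⟨v, hv, hvc⟩ := h.occupied c hc
    rcases le_total 1 (dot (G.k v) b) with hle | hle
    · exact Finset.mem_union_left _ (mem_restrict.2 ⟨hc, v, Finset.mem_filter.2 ⟨hv, hle⟩, hvc⟩)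
    · exact Finset.mem_union_right _ (mem_restrict.2 ⟨hc, v, Finset.mem_filter.2 ⟨hv, hle⟩, hvc⟩)
  have hcross : ∀ c ∈ A ∩ D, dot b c = 1 := by
    intro c hc
    obtain ⟨hcA, hcD⟩ := Finset.mem_inter.1 hc
    obtain ⟨v, hv, hvb, hvc⟩ := memA hcA
    obtain ⟨w, hw, hwb, hwc⟩ := memD hcD
    exact dot_eq_one_of_sides (hdis (hAL hcA)) (G.norm_lt w) (G.norm_lt v) hwc hvc hwb hvb
  have hperps : ∀ {P Q : Finset (ℝ × ℝ)}, (∀ c ∈ P ∩ Q, dot b c = 1) →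
      (perps P b).card = (P ∩ Q).card + (perps (P \ Q) b).card := by
    intro P Q hPQ
    rw [← Finset.card_union_of_disjoint]
    · congr 1
      ext c
      simp only [Finset.mem_union, mem_perps, Finset.mem_sdiff]
      constructor
      · rintro ⟨hc, hbc⟩
        by_cases hq : c ∈ Q
        · exact .inl (Finset.mem_inter.2 ⟨hc, hq⟩)
        · exact .inr ⟨⟨hc, hq⟩, hbc⟩
      · rintro (hc | ⟨⟨hc, -⟩, hbc⟩)
        · exact ⟨(Finset.mem_inter.1 hc).1, hPQ c hc⟩
        · exact ⟨hc, hbc⟩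
    · refine Finset.disjoint_left.2 fun c hc hc' => ?_
      exact (Finset.mem_sdiff.1 (mem_perps.1 hc').1).2 (Finset.mem_inter.1 hc).2
  -- orthogonal pairs whose members are occupied on different sides only
  let lost := ((A \ D) ×ˢ (D \ A)).filter fun p => dot p.1 p.2 = 1
  have hlost : lost.card ≤ (perps (A \ D) b).card + (perps (D \ A) b).card := by
    have h1 : (lost.filter fun p => dot b p.1 = 1).card ≤ (perps (A \ D) b).card := by
      refine Finset.card_le_card_of_injOn Prod.fst ?_ ?_
      · intro p hp
        obtain ⟨hp, hpb⟩ := Finset.mem_filter.1 hp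
        exact mem_perps.2 ⟨(Finset.mem_product.1 (Finset.mem_filter.1 hp).1).1, hpb⟩
      · intro p hp q hq hpq
        obtain ⟨hp, hpb⟩ := Finset.mem_filter.1 hp
        obtain ⟨hp, hpo⟩ := Finset.mem_filter.1 hp
        obtain ⟨hq, -⟩ := Finset.mem_filter.1 hq
        obtain ⟨hq, hqo⟩ := Finset.mem_filter.1 hq
        obtain ⟨pL, -⟩ := memAD (Finset.mem_product.1 hp).1
        obtain ⟨pL', y, hy, hyb, hyp⟩ := memDA (Finset.mem_product.1 hp).2
        obtain ⟨qL', z, hz, hzb, hzq⟩ := memDA (Finset.mem_product.1 hq).2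
        refine Prod.ext hpq (h.perp_unique hb hbL pL pL' qL' (by rwa [dot_comm]) hpo
          (by rwa [hpq]) hx hxb hy hyp hz hzq ?_)
        exact mul_nonneg_of_nonpos_of_nonpos (by linarith) (by linarith)
    have h2 : (lost.filter fun p => dot b p.2 = 1).card ≤ (perps (D \ A) b).card := by
      refine Finset.card_le_card_of_injOn Prod.snd ?_ ?_
      · intro p hp
        obtain ⟨hp, hpb⟩ := Finset.mem_filter.1 hp
        exact mem_perps.2 ⟨(Finset.mem_product.1 (Finset.mem_filter.1 hp).1).2, hpb⟩
      · intro p hp q hq hpq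
        obtain ⟨hp, hpb⟩ := Finset.mem_filter.1 hp
        obtain ⟨hp, hpo⟩ := Finset.mem_filter.1 hp
        obtain ⟨hq, -⟩ := Finset.mem_filter.1 hq
        obtain ⟨hq, hqo⟩ := Finset.mem_filter.1 hq
        obtain ⟨pL, -⟩ := memDA (Finset.mem_product.1 hp).2
        obtain ⟨pL', y, hy, hyb, hyp⟩ := memAD (Finset.mem_product.1 hp).1
        obtain ⟨qL', z, hz, hzb, hzq⟩ := memAD (Finset.mem_product.1 hq).1
        refine Prod.ext (h.perp_unique hb hbL pL pL' qL' (by rwa [dot_comm])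
          (by rwa [dot_comm]) (by rwa [hpq, dot_comm]) hx hxb hy hyp hz hzq ?_) hpq
        exact mul_nonneg (by linarith) (by linarith)
    have h3 : lost ⊆ (lost.filter fun p => dot b p.1 = 1) ∪ lost.filter fun p => dot b p.2 = 1 := by
      intro p hp
      obtain ⟨hp', hpo⟩ := Finset.mem_filter.1 hp
      by_contra hnot
      have n1 : dot b p.1 ≠ 1 := fun e =>
        hnot (Finset.mem_union_left _ (Finset.mem_filter.2 ⟨hp, e⟩))
      have n2 : dot b p.2 ≠ 1 := fun e =>
        hnot (Finset.mem_union_right _ (Finset.mem_filter.2 ⟨hp, e⟩))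
      obtain ⟨c1, v, hv, hvb, hvc⟩ := memAD (Finset.mem_product.1 hp').1
      obtain ⟨c2, w, hw, hwb, hwc⟩ := memDA (Finset.mem_product.1 hp').2
      obtain ⟨z, hz, hz1, hz2⟩ := exists_common_point (G.one_lt _ (h.subset c1))
        (G.one_lt _ (h.subset c2)) hpo
      have s1 := same_side_of_ne (hdis c1) n1 (G.norm_lt v) hz hvc hz1
      have s2 := same_side_of_ne (hdis c2) n2 (G.norm_lt w) hz hwc hz2
      have t1 : 0 < dot z b - 1 := pos_of_mul_pos_right s1 (by linarith)
      nlinarith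
    calc lost.card ≤ _ := Finset.card_le_card h3
      _ ≤ _ := Finset.card_union_le _ _
      _ ≤ _ := add_le_add h1 h2
  have hpairs : (orthPairs L).card ≤ (orthPairs A).card + (orthPairs D).card + 2 * lost.card := by
    have hsub : orthPairs L ⊆ (orthPairs A ∪ orthPairs D) ∪ (lost ∪ lost.image Prod.swap) := by
      intro p hp
      obtain ⟨⟨p1, p2⟩, hpo⟩ := mem_orthPairs.1 hp
      rw [← hcover, Finset.mem_union] at p1 p2
      simp only [Finset.mem_union]
      by_cases a1 : p.1 ∈ A <;> by_cases a2 : p.2 ∈ A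
      · exact .inl (.inl (mem_orthPairs.2 ⟨⟨a1, a2⟩, hpo⟩))
      · have d2 := p2.resolve_left a2
        by_cases d1 : p.1 ∈ D
        · exact .inl (.inr (mem_orthPairs.2 ⟨⟨d1, d2⟩, hpo⟩))
        · exact .inr (.inl (Finset.mem_filter.2 ⟨Finset.mem_product.2
            ⟨Finset.mem_sdiff.2 ⟨a1, d1⟩, Finset.mem_sdiff.2 ⟨d2, a2⟩⟩, hpo⟩))
      · have d1 := p1.resolve_left a1
        by_cases d2 : p.2 ∈ D
        · exact .inl (.inr (mem_orthPairs.2 ⟨⟨d1, d2⟩, hpo⟩))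
        · refine .inr (.inr (Finset.mem_image.2 ⟨p.swap, Finset.mem_filter.2
            ⟨Finset.mem_product.2 ⟨Finset.mem_sdiff.2 ⟨a2, d2⟩, Finset.mem_sdiff.2 ⟨d1, a1⟩⟩, ?_⟩,
            p.swap_swap⟩))
          exact (dot_comm _ _).trans hpo
      · exact .inl (.inr (mem_orthPairs.2 ⟨⟨p1.resolve_left a1, p2.resolve_left a2⟩, hpo⟩))
    have e1 := Finset.card_le_card hsub
    have e2 := Finset.card_union_le (orthPairs A ∪ orthPairs D) (lost ∪ lost.image Prod.swap)
    have e3 := Finset.card_union_le (orthPairs A) (orthPairs D)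
    have e4 := Finset.card_union_le lost (lost.image Prod.swap)
    have e5 : (lost.image Prod.swap).card ≤ lost.card := Finset.card_image_le
    omega
  have hbA : b ∉ A := fun hbA => hbL (hAL hbA)
  have hbD : b ∉ D := fun hbD => hbL (hDL hbD)
  have i1 := card_orthPairs_insert hbA
  have i2 := card_orthPairs_insert hbD
  have i3 := hperps hcross
  have i4 := hperps (P := D) (Q := A) (by rwa [Finset.inter_comm])
  have i5 := Finset.card_union_add_card_inter A D
  rw [hcover] at i5
  rw [Finset.inter_comm D A] at i4
  rw [Finset.card_insert_of_notMem hbA, Finset.card_insert_of_notMem hbD]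
  omega

/-- Cutting a region along a line does not increase the potential. -/
theorem IsRegion.potential_cut {V : Finset ι} {L : Finset (ℝ × ℝ)} (h : G.IsRegion V L) {b : ℝ × ℝ}
    (hb : b ∈ G.lines) (hbL : b ∉ L) (ho : ∃ v ∈ V, dot (G.k v) b = 1) :
    G.potential (V.filter fun v => 1 ≤ dot (G.k v) b)
        (insert b (G.restrict L (V.filter fun v => 1 ≤ dot (G.k v) b))) +
      G.potential (V.filter fun v => dot (G.k v) b ≤ 1)
        (insert b (G.restrict L (V.filter fun v => dot (G.k v) b ≤ 1))) ≤ G.potential V L := by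
  have h1 := sum_vertexWeight_cut (G := G) (V := V) hbL
  have h2 := sum_edgeWeight_cut (V := V) (L := L) hb
  have h3 := h.boundary_cut hb hbL ho
  rify at h3
  simp only [potential]
  linarith

end Config

end Klein

namespace PlaneDrawing

variable {ι : Type*}

/-- The pairs of points of `S` with consecutive abscissas. -/
noncomputable def consecutivePairs (x : ι → ℝ) (S : Finset ι) : Finset (ι × ι) :=
  (S ×ˢ S).filter fun e => x e.1 < x e.2 ∧ ∀ v ∈ S, ¬(x e.1 < x v ∧ x v < x e.2)

theorem mem_consecutivePairs {x : ι → ℝ} {S : Finset ι} {e : ι × ι} :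
    e ∈ consecutivePairs x S ↔ (e.1 ∈ S ∧ e.2 ∈ S) ∧ x e.1 < x e.2 ∧
      ∀ v ∈ S, ¬(x e.1 < x v ∧ x v < x e.2) := by
  rw [consecutivePairs, Finset.mem_filter, Finset.mem_product]

theorem card_le_card_consecutivePairs {x : ι → ℝ} {S : Finset ι} (hx : Set.InjOn x S) :
    S.card ≤ (consecutivePairs x S).card + 1 := by
  rcases S.eq_empty_or_nonempty with rfl | hS
  · simp
  obtain ⟨m, hm, hmax⟩ := S.exists_max_image x hS
  have hsub : S.erase m ⊆ (consecutivePairs x S).image Prod.fst := by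
    intro u hu
    obtain ⟨hum, hu⟩ := Finset.mem_erase.1 hu
    have hlt : x u < x m := (hmax u hu).lt_of_ne fun h => hum (hx hu hm h)
    obtain ⟨w, hw, hmin⟩ := (S.filter fun w => x u < x w).exists_min_image x
      ⟨m, Finset.mem_filter.2 ⟨hm, hlt⟩⟩
    rw [Finset.mem_filter] at hw
    refine Finset.mem_image.2 ⟨(u, w), mem_consecutivePairs.2 ⟨⟨hu, hw.1⟩, hw.2, ?_⟩, rfl⟩
    rintro v hv ⟨h1, h2⟩
    exact (hmin v (Finset.mem_filter.2 ⟨hv, h1⟩)).not_gt h2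
  have h1 := (Finset.card_le_card hsub).trans Finset.card_image_le
  rw [Finset.card_erase_of_mem hm] at h1
  omega

end PlaneDrawing

namespace Klein.Config

open PlaneDrawing

variable {ι : Type*} (G : Config ι)

/-- Abscissa of the pole of `v` after a shear. -/
noncomputable def abscissa (t : ℝ) (v : ι) : ℝ := (G.k v).1 + t * (G.k v).2

/-- Ordinate of the pole of `v`. -/
noncomputable def ordinate (v : ι) : ℝ := (G.k v).2

/-- A region which is not cut by any line carrying one of its poles. -/
structure IsLeaf (V : Finset ι) (L : Finset (ℝ × ℝ)) : Prop extends G.IsRegion V L where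
  uncut : ∀ b ∈ G.lines, (∃ v ∈ V, dot (G.k v) b = 1) → G.Supports V b

/-- The poles of `V` on the line `c`. -/
noncomputable def onLine (V : Finset ι) (c : ℝ × ℝ) : Finset ι :=
  V.filter fun v => dot (G.k v) c = 1

/-- The segments between poles of `V` that are consecutive on a line of `L`. -/
noncomputable def chords (t : ℝ) (V : Finset ι) (L : Finset (ℝ × ℝ)) : Finset (ι × ι) :=
  L.biUnion fun c => consecutivePairs (G.abscissa t) (G.onLine V c)

/-- The segments between adjacent poles of `V` not on a common line of `L`. -/
noncomputable def innerEdges (t : ℝ) (V : Finset ι) (L : Finset (ℝ × ℝ)) : Finset (ι × ι) :=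
  (V ×ˢ V).filter fun e => G.abscissa t e.1 < G.abscissa t e.2 ∧ G.adj e.1 e.2 ∧
    ¬G.SharesLine L e.1 e.2

variable {G}

theorem mem_onLine {V : Finset ι} {c : ℝ × ℝ} {v : ι} :
    v ∈ G.onLine V c ↔ v ∈ V ∧ dot (G.k v) c = 1 := Finset.mem_filter

theorem mem_chords {t : ℝ} {V : Finset ι} {L : Finset (ℝ × ℝ)} {e : ι × ι} :
    e ∈ G.chords t V L ↔ ∃ c ∈ L, e ∈ consecutivePairs (G.abscissa t) (G.onLine V c) :=
  Finset.mem_biUnion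

theorem mem_innerEdges {t : ℝ} {V : Finset ι} {L : Finset (ℝ × ℝ)} {e : ι × ι} :
    e ∈ G.innerEdges t V L ↔ (e.1 ∈ V ∧ e.2 ∈ V) ∧ G.abscissa t e.1 < G.abscissa t e.2 ∧
      G.adj e.1 e.2 ∧ ¬G.SharesLine L e.1 e.2 := by
  rw [innerEdges, Finset.mem_filter, Finset.mem_product]

theorem exists_injOn_abscissa (V : Finset ι) : ∃ t, Set.InjOn (G.abscissa t) V := by
  obtain ⟨t, ht⟩ := Infinite.exists_notMem_finset ((V ×ˢ V).image fun e =>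
    -((G.k e.1).1 - (G.k e.2).1) / ((G.k e.1).2 - (G.k e.2).2))
  refine ⟨t, fun p hp q hq h => G.k_injective ?_⟩
  simp only [abscissa] at h
  by_cases h0 : (G.k p).2 - (G.k q).2 = 0
  · have h2 : (G.k p).2 = (G.k q).2 := by linarith
    exact Prod.ext (by rw [h2] at h; linarith) h2
  · refine absurd (Finset.mem_image.2 ⟨(p, q), Finset.mem_product.2 ⟨hp, hq⟩, ?_⟩) ht
    rw [div_eq_iff h0]
    linarith

theorem exists_comb_of_height {t T : ℝ} {e : ι × ι} (h1 : G.abscissa t e.1 < T)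
    (h2 : T < G.abscissa t e.2) : ∃ s r, 0 < s ∧ 0 < r ∧ s + r = 1 ∧
      G.Comb (T - t * height (G.abscissa t) G.ordinate e T,
        height (G.abscissa t) G.ordinate e T) e.1 e.2 s r := by
  have h0 : 0 < G.abscissa t e.2 - G.abscissa t e.1 := by linarith
  refine ⟨(G.abscissa t e.2 - T) / (G.abscissa t e.2 - G.abscissa t e.1),
    (T - G.abscissa t e.1) / (G.abscissa t e.2 - G.abscissa t e.1),
    div_pos (by linarith) h0, div_pos (by linarith) h0, ?_, ?_⟩
  · rw [← add_div, div_eq_one_iff_eq h0.ne']; ring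
  have hy : height (G.abscissa t) G.ordinate e T =
      (G.abscissa t e.2 - T) / (G.abscissa t e.2 - G.abscissa t e.1) * (G.k e.1).2 +
      (T - G.abscissa t e.1) / (G.abscissa t e.2 - G.abscissa t e.1) * (G.k e.2).2 := by
    simp only [height, PlaneDrawing.slope, ordinate]
    field_simp
    ring
  refine ⟨?_, hy⟩
  have hx : T = (G.abscissa t e.2 - T) / (G.abscissa t e.2 - G.abscissa t e.1) * G.abscissa t e.1 +
      (T - G.abscissa t e.1) / (G.abscissa t e.2 - G.abscissa t e.1) * G.abscissa t e.2 := by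
    field_simp
    ring
  have e1 : (G.k e.1).1 = G.abscissa t e.1 - t * (G.k e.1).2 := by rw [abscissa]; ring
  have e2 : (G.k e.2).1 = G.abscissa t e.2 - t * (G.k e.2).2 := by rw [abscissa]; ring
  change T - t * height (G.abscissa t) G.ordinate e T = _
  rw [hy, e1, e2]
  linear_combination hx

theorem exists_comb_of_height_eq {t : ℝ} {e : ι × ι} {v : ι}
    (h1 : G.abscissa t e.1 < G.abscissa t v)
    (h2 : G.abscissa t v < G.abscissa t e.2)
    (h : height (G.abscissa t) G.ordinate e (G.abscissa t v) = G.ordinate v) :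
    ∃ s r, 0 < s ∧ 0 < r ∧ s + r = 1 ∧ G.Comb (G.k v) e.1 e.2 s r := by
  obtain ⟨s, r, hs, hr, hsr, hc⟩ := exists_comb_of_height h1 h2
  refine ⟨s, r, hs, hr, hsr, ?_⟩
  rw [h] at hc
  convert hc using 1
  exact Prod.ext (by simp [abscissa, ordinate]) rfl

/-- Poles on a line lie at the height of any segment of that line. -/
theorem height_eq_of_onLine {t : ℝ} {c : ℝ × ℝ} {e : ι × ι} {v : ι}
    (hlt : G.abscissa t e.1 < G.abscissa t e.2) (hu : dot (G.k e.1) c = 1)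
    (hw : dot (G.k e.2) c = 1) (hv : dot (G.k v) c = 1) :
    height (G.abscissa t) G.ordinate e (G.abscissa t v) = G.ordinate v := by
  have key : ∀ v, dot (G.k v) c = 1 →
      c.1 * G.abscissa t v + (c.2 - t * c.1) * G.ordinate v = 1 := by
    intro v hv
    rw [← hv]
    simp only [dot, abscissa, ordinate]
    ring
  replace hu := key _ hu
  replace hw := key _ hw
  replace hv := key _ hv
  have hβ : c.2 - t * c.1 ≠ 0 := by
    intro h0
    rw [h0] at hu hw
    have : c.1 * (G.abscissa t e.2 - G.abscissa t e.1) = 0 := by linarith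
    rcases mul_eq_zero.1 this with h | h
    · rw [h] at hu; simp at hu
    · linarith
  have h0 : G.abscissa t e.2 - G.abscissa t e.1 ≠ 0 := by linarith
  simp only [height, PlaneDrawing.slope]
  field_simp
  apply mul_left_cancel₀ hβ
  linear_combination (G.abscissa t v - G.abscissa t e.1) * (hw - hu) +
    (G.abscissa t e.2 - G.abscissa t e.1) * (hu - hv)

theorem Comb.dot_eq_one {z c : ℝ × ℝ} {u w : ι} {s r : ℝ} (h : G.Comb z u w s r) (hsr : s + r = 1)
    (hu : Klein.dot (G.k u) c = 1) (hw : Klein.dot (G.k w) c = 1) : Klein.dot z c = 1 := by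
  rw [h.dot, hu, hw]; linarith

theorem Comb.ends_eq_one {V : Finset ι} {z c : ℝ × ℝ} {u w : ι} {s r : ℝ} (h : G.Comb z u w s r)
    (hs : 0 < s) (hr : 0 < r) (hsr : s + r = 1) (hc : G.Supports V c) (hu : u ∈ V) (hw : w ∈ V)
    (hz : Klein.dot z c = 1) : Klein.dot (G.k u) c = 1 ∧ Klein.dot (G.k w) c = 1 := by
  rw [h.dot] at hz
  have h1 : ∀ {a b : ℝ}, 0 < a → 0 ≤ b → a * b ≤ 0 → b = 0 := fun ha hb hab =>
    hb.antisymm' (by nlinarith)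
  rcases hc with hc | hc
  · have := mul_nonneg hs.le (sub_nonneg.2 (hc u hu))
    have := mul_nonneg hr.le (sub_nonneg.2 (hc w hw))
    constructor
    · linarith [h1 hs (sub_nonneg.2 (hc u hu)) (by linarith)]
    · linarith [h1 hr (sub_nonneg.2 (hc w hw)) (by linarith)]
  · have := mul_nonneg hs.le (sub_nonneg.2 (hc u hu))
    have := mul_nonneg hr.le (sub_nonneg.2 (hc w hw))
    constructor
    · linarith [h1 hs (sub_nonneg.2 (hc u hu)) (by linarith)]
    · linarith [h1 hr (sub_nonneg.2 (hc w hw)) (by linarith)]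

theorem abscissa_lt_of_mem {t : ℝ} {V : Finset ι} {L : Finset (ℝ × ℝ)} {e : ι × ι}
    (he : e ∈ G.innerEdges t V L ∪ G.chords t V L) :
    (e.1 ∈ V ∧ e.2 ∈ V) ∧ G.abscissa t e.1 < G.abscissa t e.2 := by
  rcases Finset.mem_union.1 he with h | h
  · have := mem_innerEdges.1 h
    exact ⟨this.1, this.2.1⟩
  · obtain ⟨c, -, h⟩ := mem_chords.1 h
    have := mem_consecutivePairs.1 h
    exact ⟨⟨(mem_onLine.1 this.1.1).1, (mem_onLine.1 this.1.2).1⟩, this.2.1⟩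

theorem height_ne_of_mem {t : ℝ} {V : Finset ι} {L : Finset (ℝ × ℝ)} {e : ι × ι}
    (he : e ∈ G.innerEdges t V L ∪ G.chords t V L) {v : ι} (hv : v ∈ V)
    (h1 : G.abscissa t e.1 < G.abscissa t v) (h2 : G.abscissa t v < G.abscissa t e.2) :
    height (G.abscissa t) G.ordinate e (G.abscissa t v) ≠ G.ordinate v := by
  intro h
  obtain ⟨s, r, hs, hr, hsr, hc⟩ := exists_comb_of_height_eq h1 h2 h
  rcases Finset.mem_union.1 he with h | h
  · exact hc.false_of_vertex (mem_innerEdges.1 h).2.2.1 hs hr hsr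
  · obtain ⟨c, -, h⟩ := mem_chords.1 h
    have h := mem_consecutivePairs.1 h
    exact h.2.2 v (mem_onLine.2 ⟨hv, hc.dot_eq_one hsr (mem_onLine.1 h.1.1).2
      (mem_onLine.1 h.1.2).2⟩) ⟨h1, h2⟩

theorem IsRegion.not_cross_chord {t T : ℝ} {V : Finset ι} {L : Finset (ℝ × ℝ)}
    (hV : G.IsRegion V L) (ht : Set.InjOn (G.abscissa t) V) {e f : ι × ι}
    (he : e ∈ G.chords t V L) (hf : f ∈ G.innerEdges t V L ∪ G.chords t V L) (hef : e.1 ≠ f.1)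
    (he1 : G.abscissa t e.1 < T) (hf1 : G.abscissa t f.1 < T) (he2 : T < G.abscissa t e.2)
    (hf2 : T < G.abscissa t f.2) :
    height (G.abscissa t) G.ordinate e T ≠ height (G.abscissa t) G.ordinate f T := by
  intro h
  obtain ⟨s, r, hs, hr, hsr, hc⟩ := exists_comb_of_height he1 he2
  obtain ⟨a, b, ha, hb, hab, hc'⟩ := exists_comb_of_height hf1 hf2
  rw [h] at hc
  obtain ⟨c, hcL, hce⟩ := mem_chords.1 he
  have hce := mem_consecutivePairs.1 hce
  have o1 := mem_onLine.1 hce.1.1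
  have o2 := mem_onLine.1 hce.1.2
  obtain ⟨⟨f1, f2⟩, hflt⟩ := abscissa_lt_of_mem hf
  obtain ⟨p1, p2⟩ := hc'.ends_eq_one ha hb hab (hV.supports c hcL) f1 f2
    (hc.dot_eq_one hsr o1.2 o2.2)
  rcases lt_trichotomy (G.abscissa t e.1) (G.abscissa t f.1) with hlt | heq | hlt
  · exact hce.2.2 f.1 (mem_onLine.2 ⟨f1, p1⟩) ⟨hlt, hf1.trans he2⟩
  · exact hef (ht o1.1 f1 heq)
  · exact height_ne_of_mem hf o1.1 hlt (he1.trans hf2) (height_eq_of_onLine hflt p1 p2 o1.2)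

theorem IsRegion.isPlane {t : ℝ} {V : Finset ι} {L : Finset (ℝ × ℝ)}
    (hV : G.IsRegion V L) (ht : Set.InjOn (G.abscissa t) V) :
    IsPlane V (G.innerEdges t V L ∪ G.chords t V L) (G.abscissa t) G.ordinate where
  inj := ht
  fst_mem e he := (abscissa_lt_of_mem he).1.1
  snd_mem e he := (abscissa_lt_of_mem he).1.2
  lt e he := (abscissa_lt_of_mem he).2
  vertex e he v hv := height_ne_of_mem he hv
  cross e he f hf h1 h2 T a1 a2 a3 a4 := by
    by_cases hec : e ∈ G.chords t V L
    · exact hV.not_cross_chord ht hec hf h1 a1 a2 a3 a4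
    by_cases hfc : f ∈ G.chords t V L
    · exact (hV.not_cross_chord ht hfc he h1.symm a2 a1 a4 a3).symm
    intro h
    have he := mem_innerEdges.1 ((Finset.mem_union.1 he).resolve_right hec)
    have hf := mem_innerEdges.1 ((Finset.mem_union.1 hf).resolve_right hfc)
    obtain ⟨s, r, hs, hr, hsr, hc⟩ := exists_comb_of_height a1 a3
    obtain ⟨a, b, ha, hb, hab, hc'⟩ := exists_comb_of_height a2 a4
    rw [h] at hc
    refine hc.false_of_disjoint hc' (.inl he.2.2.1) (.inl hf.2.2.1) hs hr.le ha hb.le hsr hab h1 ?_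
      ?_ h2
    · intro h'
      rw [h'] at a1
      exact a1.not_gt a4
    · intro h'
      rw [h'] at a3
      exact a3.not_gt a2

/-- The edges and chords of a leaf form a plane drawing, whose poles on lines are on the boundary
of the convex hull. -/
theorem IsLeaf.card_edges_le {t : ℝ} {V : Finset ι} {L : Finset (ℝ × ℝ)} (hV : G.IsLeaf V L)
    (ht : Set.InjOn (G.abscissa t) V) (h2 : 2 ≤ V.card) :
    (G.innerEdges t V L).card + (G.chords t V L).card +
      (V.filter fun v => 0 < (G.through G.lines v).card).card + 3 ≤ 3 * V.card := by
  have hdisj : Disjoint (G.innerEdges t V L) (G.chords t V L) := by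
    refine Finset.disjoint_left.2 fun e he he' => (mem_innerEdges.1 he).2.2.2 ?_
    obtain ⟨c, hc, h⟩ := mem_chords.1 he'
    have h := mem_consecutivePairs.1 h
    exact ⟨c, hc, (mem_onLine.1 h.1.1).2, (mem_onLine.1 h.1.2).2⟩
  rw [← Finset.card_union_of_disjoint hdisj]
  refine (hV.isPlane ht).card_add_card_hull_le h2 _ (Finset.filter_subset _ _) fun p hp => ?_
  obtain ⟨hp, hl⟩ := Finset.mem_filter.1 hp
  obtain ⟨b, hb⟩ := Finset.card_pos.1 hl
  obtain ⟨hb, hpb⟩ := mem_through.1 hb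
  have hne : b.1 ≠ 0 ∨ b.2 - t * b.1 ≠ 0 := by
    by_contra! h
    have h1 := G.one_lt b hb
    have h2 : b.2 = 0 := by rw [← h.2, h.1, mul_zero, sub_zero]
    rw [dot, h.1, h2] at h1
    norm_num at h1
  have key : ∀ w, b.1 * (G.abscissa t w - G.abscissa t p) +
      (b.2 - t * b.1) * (G.ordinate w - G.ordinate p) = dot (G.k w) b - 1 := by
    intro w
    rw [← hpb]
    simp only [dot, abscissa, ordinate]
    ring
  rcases hV.uncut b hb ⟨p, hp, hpb⟩ with h | h
  · exact ⟨b.1, b.2 - t * b.1, hne, fun w hw => by rw [key]; linarith [h w hw]⟩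
  · exact ⟨-b.1, -(b.2 - t * b.1), by simpa only [neg_ne_zero] using hne,
      fun w hw => by linarith [h w hw, key w]⟩

theorem card_onLine_le_card_chords {t : ℝ} {V : Finset ι} {L : Finset (ℝ × ℝ)} (hL : L ⊆ G.lines)
    (ht : Set.InjOn (G.abscissa t) V) :
    ∑ v ∈ V, (G.through L v).card ≤ (G.chords t V L).card + L.card := by
  have h1 : ∑ v ∈ V, (G.through L v).card = ∑ c ∈ L, (G.onLine V c).card := by
    simp only [through, onLine, Finset.card_filter]
    exact Finset.sum_comm
  rw [h1, chords, Finset.card_biUnion, Finset.card_eq_sum_ones, ← Finset.sum_add_distrib]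
  · exact Finset.sum_le_sum fun c _ => card_le_card_consecutivePairs
      (ht.mono fun v hv => (mem_onLine.1 hv).1)
  · intro c hc d hd hcd
    refine Finset.disjoint_left.2 fun e he he' => ?_
    have he := mem_consecutivePairs.1 he
    have he' := mem_consecutivePairs.1 he'
    have := eq_of_mem_of_mem (hL hc) (hL hd) hcd (mem_onLine.1 he.1.1).2 (mem_onLine.1 he'.1.1).2
      (mem_onLine.1 he.1.2).2 (mem_onLine.1 he'.1.2).2
    exact he.2.1.ne (by rw [this])

theorem edgeWeight_comm (L : Finset (ℝ × ℝ)) (u w : ι) :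
    G.edgeWeight L u w = G.edgeWeight L w u := by
  have h1 : G.adj u w ↔ G.adj w u := ⟨G.adj_symm _ _, G.adj_symm _ _⟩
  have h2 : G.SharesLine L u w ↔ G.SharesLine L w u := by simp only [SharesLine, and_comm]
  simp only [edgeWeight, h1, h2]

theorem sum_edgeWeight_le {t : ℝ} {V : Finset ι} {L : Finset (ℝ × ℝ)}
    (ht : Set.InjOn (G.abscissa t) V) :
    ∑ u ∈ V, ∑ w ∈ V, G.edgeWeight L u w ≤
      44 * (G.innerEdges t V L).card + 22 * (G.chords t V L).card := by
  have hsplit : ∑ u ∈ V, ∑ w ∈ V, G.edgeWeight L u w =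
      2 * ∑ u ∈ V, ∑ w ∈ V,
        if G.abscissa t u < G.abscissa t w then G.edgeWeight L u w else 0 := by
    rw [two_mul]
    nth_rw 3 [Finset.sum_comm]
    simp only [← Finset.sum_add_distrib]
    refine Finset.sum_congr rfl fun u hu => Finset.sum_congr rfl fun w hw => ?_
    rcases lt_trichotomy (G.abscissa t u) (G.abscissa t w) with h | h | h
    · rw [if_pos h, if_neg h.not_gt, add_zero]
    · rw [if_neg h.not_lt, if_neg h.not_gt, add_zero, ht hu hw h, edgeWeight,
        if_neg fun h => G.adj_ne _ _ h rfl]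
    · rw [if_neg h.not_gt, if_pos h, zero_add, edgeWeight_comm]
  have hle : ∀ e ∈ V ×ˢ V,
      (if G.abscissa t e.1 < G.abscissa t e.2 then G.edgeWeight L e.1 e.2 else 0) ≤
      22 * (if e ∈ G.innerEdges t V L then 1 else 0) +
        11 * (if e ∈ G.chords t V L then 1 else 0) := by
    intro e he
    have he := Finset.mem_product.1 he
    have h0 : (0 : ℝ) ≤ 22 * (if e ∈ G.innerEdges t V L then 1 else 0) := by positivity
    have h0' : (0 : ℝ) ≤ 11 * (if e ∈ G.chords t V L then 1 else 0) := by positivity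
    by_cases h1 : G.abscissa t e.1 < G.abscissa t e.2
    swap
    · rw [if_neg h1]; linarith
    by_cases h2 : G.adj e.1 e.2
    swap
    · rw [if_pos h1, edgeWeight, if_neg h2]; linarith
    by_cases h3 : G.SharesLine L e.1 e.2
    · have : e ∈ G.chords t V L := by
        obtain ⟨c, hc, p1, p2⟩ := h3
        refine mem_chords.2 ⟨c, hc, mem_consecutivePairs.2 ⟨⟨mem_onLine.2 ⟨he.1, p1⟩,
          mem_onLine.2 ⟨he.2, p2⟩⟩, h1, fun v hv hlt => ?_⟩⟩
        obtain ⟨s, r, hs, hr, hsr, hcb⟩ := exists_comb_of_height_eq hlt.1 hlt.2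
          (height_eq_of_onLine h1 p1 p2 (mem_onLine.1 hv).2)
        exact hcb.false_of_vertex h2 hs hr hsr
      rw [if_pos h1, edgeWeight, if_pos h2, if_pos h3, if_pos this]
      linarith
    · have : e ∈ G.innerEdges t V L := mem_innerEdges.2 ⟨he, h1, h2, h3⟩
      rw [if_pos h1, edgeWeight, if_pos h2, if_neg h3, if_pos this]
      linarith
  rw [hsplit, ← Finset.sum_product']
  have h3 := Finset.sum_le_sum hle
  rw [Finset.sum_add_distrib, ← Finset.mul_sum, ← Finset.mul_sum, Finset.sum_boole,
    Finset.sum_boole] at h3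
  have h1 : ((V ×ˢ V).filter fun e => e ∈ G.innerEdges t V L).card ≤ (G.innerEdges t V L).card :=
    Finset.card_le_card fun e he => (Finset.mem_filter.1 he).2
  have h2 : ((V ×ˢ V).filter fun e => e ∈ G.chords t V L).card ≤ (G.chords t V L).card :=
    Finset.card_le_card fun e he => (Finset.mem_filter.1 he).2
  rify at h1 h2
  linarith

variable (G) in
/-- The contribution of a vertex to the potential of a leaf. -/
noncomputable def leafWeight (L : Finset (ℝ × ℝ)) (v : ι) : ℝ :=
  G.vertexWeight L v - 132 + 44 * (if 0 < (G.through G.lines v).card then 1 else 0) +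
    22 * (G.through L v).card

theorem IsLeaf.le_potential {V : Finset ι} {L : Finset (ℝ × ℝ)} (hV : G.IsLeaf V L)
    (h2 : 2 ≤ V.card) :
    ∑ v ∈ V, G.leafWeight L v + 84 * (L.card : ℝ) - 53 * ((orthPairs L).card : ℝ) / 2 - 80 ≤
      G.potential V L := by
  obtain ⟨t, ht⟩ := exists_injOn_abscissa (G := G) V
  have h1 := hV.card_edges_le ht h2
  have h3 := card_onLine_le_card_chords hV.subset ht
  have h4 := sum_edgeWeight_le (L := L) ht
  generalize hP : (V.filter fun v => 0 < (G.through G.lines v).card).card = P at h1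
  rify at h1 h3
  simp only [potential, leafWeight, Finset.sum_add_distrib, Finset.sum_sub_distrib,
    ← Finset.mul_sum, Finset.sum_boole, Finset.sum_const, nsmul_eq_mul, hP]
  linarith

end Klein.Config

namespace Klein.Config

variable {ι : Type*} {G : Config ι} {V : Finset ι} {L : Finset (ℝ × ℝ)}

theorem card_through_le (hL : L ⊆ G.lines) (v : ι) :
    (G.through L v).card ≤ (G.through G.lines v).card :=
  Finset.card_le_card (Finset.filter_subset_filter _ hL)

theorem dot_self_ne_one (hL : L ⊆ G.lines) {c : ℝ × ℝ} (hc : c ∈ L) : dot c c ≠ 1 :=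
  (G.one_lt c (hL hc)).ne'

theorem even_card_orthPairs (hL : L ⊆ G.lines) : Even (orthPairs L).card := by
  rw [← ZMod.natCast_eq_zero_iff_even, Finset.card_eq_sum_ones, Nat.cast_sum]
  refine Finset.sum_involution (fun p _ => p.swap) (fun _ _ => by decide) (fun p hp _ h => ?_)
    (fun p hp => ?_) fun p _ => p.swap_swap
  · have hp := mem_orthPairs.1 hp
    have : p.2 = p.1 := congrArg Prod.fst h
    rw [this] at hp
    exact dot_self_ne_one hL hp.1.1 hp.2
  · have hp := mem_orthPairs.1 hp
    exact mem_orthPairs.2 ⟨hp.1.symm, by rw [← hp.2]; exact dot_comm _ _⟩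

variable (G) in
/-- The poles of `V` on exactly `i` lines of `L` and `j` lines of the arrangement. -/
noncomputable def kind (V : Finset ι) (L : Finset (ℝ × ℝ)) (i j : ℕ) : Finset ι :=
  V.filter fun v => (G.through L v).card = i ∧ (G.through G.lines v).card = j

theorem mem_kind {i j : ℕ} {v : ι} : v ∈ G.kind V L i j ↔
    v ∈ V ∧ (G.through L v).card = i ∧ (G.through G.lines v).card = j := Finset.mem_filter

theorem sum_leafWeight_ge (hL : L ⊆ G.lines) :
    20 * ((V.filter fun v => (G.through L v).card = 0).card : ℝ) + 10 * (G.kind V L 1 1).card -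
      12 * (G.kind V L 1 2).card - 17 * (G.kind V L 2 2).card ≤ ∑ v ∈ V, G.leafWeight L v := by
  have h : ∀ v ∈ V, 20 * (if (G.through L v).card = 0 then 1 else 0) +
      10 * (if (G.through L v).card = 1 ∧ (G.through G.lines v).card = 1 then 1 else 0) -
      12 * (if (G.through L v).card = 1 ∧ (G.through G.lines v).card = 2 then 1 else 0) -
      17 * (if (G.through L v).card = 2 ∧ (G.through G.lines v).card = 2 then 1 else 0) ≤
      G.leafWeight L v := by
    intro v _
    have h1 := card_through_le hL v
    have h2 := G.card_through_lines_le v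
    rw [leafWeight, vertexWeight]
    generalize (G.through L v).card = i at *
    generalize (G.through G.lines v).card = j at *
    interval_cases j <;> interval_cases i <;> norm_num
  refine le_trans (le_of_eq ?_) (Finset.sum_le_sum h)
  simp only [Finset.sum_add_distrib, Finset.sum_sub_distrib, ← Finset.mul_sum, Finset.sum_boole]
  rfl

/-- Every pole of `V` on two lines of `L` yields two ordered pairs of lines of `L`. -/
theorem card_biUnion_offDiag (hL : L ⊆ G.lines) :
    ((G.kind V L 2 2).biUnion fun v => (G.through L v).offDiag).card =
      2 * (G.kind V L 2 2).card := by
  rw [Finset.card_biUnion]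
  · rw [Finset.sum_congr rfl (g := fun _ => 2), Finset.sum_const, smul_eq_mul, mul_comm]
    intro v hv
    rw [Finset.offDiag_card, (mem_kind.1 hv).2.1]
  · intro v _ w _ hvw
    refine Finset.disjoint_left.2 fun p hp hp' => hvw ?_
    rw [Finset.mem_offDiag, mem_through, mem_through] at hp hp'
    exact eq_of_mem_of_mem (hL hp.1.1) (hL hp.2.1.1) hp.2.2 hp.1.2 hp.2.1.2 hp'.1.2 hp'.2.1.2

theorem biUnion_offDiag_subset (hL : L ⊆ G.lines) :
    ((G.kind V L 2 2).biUnion fun v => (G.through L v).offDiag) ⊆ orthPairs L := by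
  intro p hp
  obtain ⟨v, -, hp⟩ := Finset.mem_biUnion.1 hp
  rw [Finset.mem_offDiag, mem_through, mem_through] at hp
  exact mem_orthPairs.2 ⟨⟨hp.1.1, hp.2.1.1⟩,
    dot_eq_one_of_mem (hL hp.1.1) (hL hp.2.1.1) hp.2.2 hp.1.2 hp.2.1.2⟩

theorem two_mul_card_kind_le (hL : L ⊆ G.lines) :
    2 * (G.kind V L 2 2).card ≤ (orthPairs L).card := by
  rw [← card_biUnion_offDiag hL]
  exact Finset.card_le_card (biUnion_offDiag_subset hL)

theorem exists_corner (hL : L ⊆ G.lines)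
    (h : (orthPairs L).card ≤ 2 * (G.kind V L 2 2).card) {c d : ℝ × ℝ} (hc : c ∈ L) (hd : d ∈ L)
    (hcd : dot c d = 1) : ∃ z, dot (G.k z) c = 1 ∧ dot (G.k z) d = 1 := by
  rw [← card_biUnion_offDiag hL] at h
  have hmem : (c, d) ∈ orthPairs L := mem_orthPairs.2 ⟨⟨hc, hd⟩, hcd⟩
  rw [← Finset.eq_of_subset_of_card_le (biUnion_offDiag_subset hL) h] at hmem
  obtain ⟨z, -, hp⟩ := Finset.mem_biUnion.1 hmem
  rw [Finset.mem_offDiag, mem_through, mem_through] at hp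
  exact ⟨z, hp.1.2, hp.2.1.2⟩

theorem IsLeaf.card_perps_add_le (hV : G.IsLeaf V L) {c : ℝ × ℝ} (hc : c ∈ L) :
    (perps L c).card + (G.onLine (G.kind V L 1 2) c).card ≤ 2 := by
  have hex : ∀ v ∈ G.onLine (G.kind V L 1 2) c, ∃ b ∈ G.lines, b ∉ L ∧ dot (G.k v) b = 1 := by
    intro v hv
    obtain ⟨h1, h2⟩ := (mem_kind.1 (mem_onLine.1 hv).1).2
    obtain ⟨b, hb, hb'⟩ := Finset.exists_mem_notMem_of_card_lt_card
      (s := G.through L v) (t := G.through G.lines v) (by omega)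
    rw [mem_through] at hb hb'
    exact ⟨b, hb.1, fun h => hb' ⟨h, hb.2⟩, hb.2⟩
  choose! f hf hfL hfv using hex
  have hcl := hV.subset hc
  have hinj : Set.InjOn f (G.onLine (G.kind V L 1 2) c) := by
    intro v hv w hw h
    have hne : c ≠ f v := fun h => hfL v hv (h ▸ hc)
    exact eq_of_mem_of_mem hcl (hf v hv) hne (mem_onLine.1 hv).2 (hfv v hv) (mem_onLine.1 hw).2
      (h ▸ hfv w hw)
  have hdisj : Disjoint (perps L c) ((G.onLine (G.kind V L 1 2) c).image f) := by
    refine Finset.disjoint_left.2 fun b hb hb' => ?_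
    obtain ⟨v, hv, rfl⟩ := Finset.mem_image.1 hb'
    exact hfL v hv (mem_perps.1 hb).1
  rw [← Finset.card_image_of_injOn hinj, ← Finset.card_union_of_disjoint hdisj]
  have hall : ∀ b ∈ perps L c ∪ (G.onLine (G.kind V L 1 2) c).image f,
      b ∈ G.lines ∧ dot c b = 1 ∧ ∃ v ∈ V, dot (G.k v) b = 1 := by
    intro b hb
    rcases Finset.mem_union.1 hb with h | h
    · have h := mem_perps.1 h
      exact ⟨hV.subset h.1, h.2, hV.occupied b h.1⟩
    · obtain ⟨v, hv, rfl⟩ := Finset.mem_image.1 h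
      have hne : c ≠ f v := fun h => hfL v hv (h ▸ hc)
      exact ⟨hf v hv, dot_eq_one_of_mem hcl (hf v hv) hne (mem_onLine.1 hv).2 (hfv v hv),
        v, (mem_kind.1 (mem_onLine.1 hv).1).1, hfv v hv⟩
  exact card_perp_le hcl (fun b hb => (hall b hb).1) (fun b hb => (hall b hb).2.1)
    (fun b hb => hV.uncut b (hall b hb).1 (hall b hb).2.2) fun b hb => (hall b hb).2.2

theorem IsLeaf.card_kind_add_le (hV : G.IsLeaf V L) :
    (G.kind V L 1 2).card + (orthPairs L).card ≤ 2 * L.card := by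
  have h1 : (G.kind V L 1 2).card = ∑ c ∈ L, (G.onLine (G.kind V L 1 2) c).card := by
    rw [Finset.card_eq_sum_ones, Finset.sum_congr rfl fun v hv => (mem_kind.1 hv).2.1.symm]
    simp only [through, onLine, Finset.card_filter]
    exact Finset.sum_comm
  rw [h1, card_orthPairs, ← Finset.sum_add_distrib, mul_comm]
  refine Finset.sum_le_card_nsmul _ _ 2 fun c hc => ?_
  rw [add_comm]
  exact hV.card_perps_add_le hc

theorem IsLeaf.card_perps_eq (hV : G.IsLeaf V L) (h : 2 * L.card ≤ (orthPairs L).card)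
    {c : ℝ × ℝ} (hc : c ∈ L) : (perps L c).card = 2 := by
  have hle : ∀ c ∈ L, (perps L c).card ≤ 2 := fun c hc =>
    (Nat.le_add_right _ _).trans (hV.card_perps_add_le hc)
  refine (Finset.sum_eq_sum_iff_of_le hle).1 ?_ c hc
  refine le_antisymm (Finset.sum_le_sum hle) ?_
  rw [← card_orthPairs, Finset.sum_const, smul_eq_mul, mul_comm]
  exact h

/-- A line with two perpendiculars has exactly one other than a given one. -/
theorem exists_other_perp {c a : ℝ × ℝ} (h : (perps L c).card = 2) (ha : a ∈ L)
    (hca : dot c a = 1) : ∃ b ∈ L, b ≠ a ∧ dot c b = 1 ∧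
      ∀ x ∈ L, dot c x = 1 → x = a ∨ x = b := by
  obtain ⟨x, y, hxy, he⟩ := Finset.card_eq_two.1 h
  have hmem : ∀ z, z ∈ L ∧ dot c z = 1 ↔ z = x ∨ z = y := fun z => by
    rw [← mem_perps, he, Finset.mem_insert, Finset.mem_singleton]
  rcases (hmem a).1 ⟨ha, hca⟩ with rfl | rfl
  · have := (hmem y).2 (.inr rfl)
    exact ⟨y, this.1, hxy.symm, this.2, fun z hz h => (hmem z).1 ⟨hz, h⟩⟩
  · have := (hmem x).2 (.inl rfl)
    exact ⟨x, this.1, hxy, this.2, fun z hz h => ((hmem z).1 ⟨hz, h⟩).symm⟩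

theorem not_triangle (hL : L ⊆ G.lines) {a b c : ℝ × ℝ} (ha : a ∈ L) (hb : b ∈ L) (hc : c ∈ L)
    (hab : dot a b = 1) (hbc : dot b c = 1) (hac : dot a c = 1) : False :=
  not_pairwise_orth (G.one_lt a (hL ha)) (G.one_lt b (hL hb)) (G.one_lt c (hL hc)) hab hbc hac

theorem ne_of_orth (hL : L ⊆ G.lines) {a b : ℝ × ℝ} (ha : a ∈ L) (hab : dot a b = 1) : a ≠ b := by
  rintro rfl
  exact dot_self_ne_one hL ha hab

/-- If every line of `L` is orthogonal to two others, then two orthogonal lines are the middle of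
a path of four lines. -/
theorem IsLeaf.exists_path (hV : G.IsLeaf V L) (h : 2 * L.card ≤ (orthPairs L).card)
    {p q : ℝ × ℝ} (hp : p ∈ L) (hq : q ∈ L) (hpq : dot p q = 1) :
    ∃ p' ∈ L, ∃ q' ∈ L, dot p p' = 1 ∧ dot q q' = 1 ∧ p' ≠ q ∧ q' ≠ p ∧ p' ≠ q' := by
  obtain ⟨p', hp', h1, h2, -⟩ := exists_other_perp (hV.card_perps_eq h hp) hq hpq
  obtain ⟨q', hq', h3, h4, -⟩ := exists_other_perp (hV.card_perps_eq h hq) hp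
    ((dot_comm q p).trans hpq)
  refine ⟨p', hp', q', hq', h2, h4, h1, h3, ?_⟩
  rintro rfl
  exact not_triangle hV.subset hp hq hp' hpq h4 h2

theorem IsLeaf.five_le_card (hV : G.IsLeaf V L) (hL : L.Nonempty)
    (h : 2 * L.card ≤ (orthPairs L).card) : 5 ≤ L.card := by
  obtain ⟨p, hp⟩ := hL
  have hS := hV.subset
  obtain ⟨q, hq⟩ : (perps L p).Nonempty :=
    Finset.card_pos.1 (by rw [hV.card_perps_eq h hp]; norm_num)
  obtain ⟨hq, hpq⟩ := mem_perps.1 hq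
  obtain ⟨p', hp', q', hq', h1, h2, n1, n2, n3⟩ := hV.exists_path h hp hq hpq
  obtain ⟨x, hx, n4, h3, -⟩ := exists_other_perp (hV.card_perps_eq h hp') hp
    ((dot_comm p' p).trans h1)
  have n5 := ne_of_orth hS hp hpq
  have n6 := ne_of_orth hS hp h1
  have n7 := ne_of_orth hS hq h2
  have n8 := ne_of_orth hS hp' h3
  have n9 : x ≠ q := by
    rintro rfl
    exact not_triangle hS hp hp' hx h1 h3 hpq
  have n10 : x ≠ q' := by
    rintro rfl
    exact not_orth_four_cycle n2.symm n1 h1 h3 ((dot_comm _ _).trans h2) ((dot_comm _ _).trans hpq)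
  have hsub : ({p, q, p', q', x} : Finset (ℝ × ℝ)) ⊆ L := by
    simp only [Finset.insert_subset_iff, Finset.singleton_subset_iff]
    exact ⟨hp, hq, hp', hq', hx⟩
  refine le_trans (le_of_eq ?_) (Finset.card_le_card hsub)
  rw [Finset.card_insert_of_notMem, Finset.card_insert_of_notMem, Finset.card_insert_of_notMem,
    Finset.card_pair n10.symm]
  all_goals
    simp only [Finset.mem_insert, Finset.mem_singleton, not_or]
  · exact ⟨n3, n8⟩
  · exact ⟨n1.symm, n7, n9.symm⟩
  · exact ⟨n5, n6, n2.symm, n4.symm⟩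

theorem IsLeaf.exists_orth_of_card_le_five (hV : G.IsLeaf V L) (h : 2 * L.card ≤ (orthPairs L).card)
    (h5 : L.card ≤ 5) {p q r s : ℝ × ℝ} (hp : p ∈ L) (hq : q ∈ L) (hr : r ∈ L) (hs : s ∈ L)
    (hpq : dot p q = 1) (hrs : dot r s = 1) (hpr : p ≠ r) (hps : p ≠ s) (hqr : q ≠ r)
    (hqs : q ≠ s) : ∃ x y, (x = p ∨ x = q) ∧ (y = r ∨ y = s) ∧ dot x y = 1 := by
  have hS := hV.subset
  obtain ⟨p', hp', q', hq', h1, h2, n1, n2, n3⟩ := hV.exists_path h hp hq hpq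
  by_contra! hno
  have n5 := ne_of_orth hS hp hpq
  have n6 := ne_of_orth hS hp h1
  have n7 := ne_of_orth hS hq h2
  have n8 := ne_of_orth hS hr hrs
  have m1 : p' ≠ r := fun e => hno p r (.inl rfl) (.inl rfl) (e ▸ h1)
  have m2 : p' ≠ s := fun e => hno p s (.inl rfl) (.inr rfl) (e ▸ h1)
  have m3 : q' ≠ r := fun e => hno q r (.inr rfl) (.inl rfl) (e ▸ h2)
  have m4 : q' ≠ s := fun e => hno q s (.inr rfl) (.inr rfl) (e ▸ h2)
  have hsub : ({p, q, p', q', r, s} : Finset (ℝ × ℝ)) ⊆ L := by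
    simp only [Finset.insert_subset_iff, Finset.singleton_subset_iff]
    exact ⟨hp, hq, hp', hq', hr, hs⟩
  have hcard := (Finset.card_le_card hsub).trans h5
  rw [Finset.card_insert_of_notMem, Finset.card_insert_of_notMem, Finset.card_insert_of_notMem,
    Finset.card_insert_of_notMem, Finset.card_pair n8] at hcard
  · omega
  all_goals
    simp only [Finset.mem_insert, Finset.mem_singleton, not_or]
  · exact ⟨m3, m4⟩
  · exact ⟨n3, m1, m2⟩
  · exact ⟨n1.symm, n7, hqr, hqs⟩
  · exact ⟨n5, n6, n2.symm, hpr, hps⟩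

theorem sum_edgeWeight_le_of_sharesLine
    (h : ∀ u ∈ V, ∀ w ∈ V, G.adj u w → G.SharesLine L u w) {M : Finset (ι × ι)}
    (hM : ∀ u ∈ V, ∀ w ∈ V, u ≠ w → G.SharesLine L u w → (u, w) ∈ M) :
    ∑ u ∈ V, ∑ w ∈ V, G.edgeWeight L u w ≤ 11 * M.card := by
  have hle : ∀ e ∈ V ×ˢ V, G.edgeWeight L e.1 e.2 ≤ 11 * if e ∈ M then 1 else 0 := by
    intro e he
    have he := Finset.mem_product.1 he
    rw [edgeWeight]
    by_cases h1 : G.adj e.1 e.2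
    · have h2 := h _ he.1 _ he.2 h1
      rw [if_pos h1, if_pos h2, if_pos (hM _ he.1 _ he.2 (G.adj_ne _ _ h1) h2), mul_one]
    · rw [if_neg h1]
      positivity
  rw [← Finset.sum_product']
  have h3 := Finset.sum_le_sum hle
  rw [← Finset.mul_sum, Finset.sum_boole] at h3
  have h1 : ((V ×ˢ V).filter fun e => e ∈ M).card ≤ M.card :=
    Finset.card_le_card fun e he => (Finset.mem_filter.1 he).2
  rify at h1
  linarith

/-- The potential is nonnegative at the corner of a right angle with one further pole on each
leg. -/
theorem IsLeaf.potential_nonneg_of_corner (hV : G.IsLeaf V L) (hm : L.card = 2)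
    (hk : (orthPairs L).card = 2) (hf : (G.kind V L 1 2).card = 2)
    (hp : (G.kind V L 2 2).card = 1) (hall : V ⊆ G.kind V L 1 2 ∪ G.kind V L 2 2) :
    0 ≤ G.potential V L := by
  have hS := hV.subset
  have hdisj : Disjoint (G.kind V L 1 2) (G.kind V L 2 2) :=
    Finset.disjoint_left.2 fun v h1 h2 => by
      have := (mem_kind.1 h1).2.1
      have := (mem_kind.1 h2).2.1
      omega
  have hVeq : V = G.kind V L 1 2 ∪ G.kind V L 2 2 :=
    hall.antisymm (Finset.union_subset (Finset.filter_subset _ _) (Finset.filter_subset _ _))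
  have hVcard : V.card = 3 := by
    rw [hVeq, Finset.card_union_of_disjoint hdisj, hf, hp]
  have hw : ∑ v ∈ V, G.vertexWeight L v = 135 := by
    rw [hVeq, Finset.sum_union hdisj]
    have h1 : ∀ v ∈ G.kind V L 1 2, G.vertexWeight L v = 54 := fun v hv => by
      rw [vertexWeight, (mem_kind.1 hv).2.1, (mem_kind.1 hv).2.2]; norm_num
    have h2 : ∀ v ∈ G.kind V L 2 2, G.vertexWeight L v = 27 := fun v hv => by
      rw [vertexWeight, (mem_kind.1 hv).2.1, (mem_kind.1 hv).2.2]; norm_num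
    rw [Finset.sum_congr rfl h1, Finset.sum_congr rfl h2, Finset.sum_const,
      Finset.sum_const, hf, hp]
    norm_num
  have hshare : ∀ u ∈ V, ∀ w ∈ V, G.adj u w → G.SharesLine L u w := by
    intro u hu w hw huw
    by_contra hno
    have hpos : ∀ v ∈ V, ∃ c ∈ L, dot (G.k v) c = 1 := by
      intro v hv
      have : 0 < (G.through L v).card := by
        rcases Finset.mem_union.1 (hall hv) with h | h
        · rw [(mem_kind.1 h).2.1]; norm_num
        · rw [(mem_kind.1 h).2.1]; norm_num
      obtain ⟨c, hc⟩ := Finset.card_pos.1 this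
      exact ⟨c, (mem_through.1 hc).1, (mem_through.1 hc).2⟩
    obtain ⟨c, hc, huc⟩ := hpos u hu
    obtain ⟨d, hd, hwd⟩ := hpos w hw
    have hcd : c ≠ d := by
      rintro rfl
      exact hno ⟨c, hc, huc, hwd⟩
    obtain ⟨z, hz⟩ := Finset.card_pos.1 (hp.symm ▸ one_pos : 0 < (G.kind V L 2 2).card)
    have hz : G.through L z = L := Finset.eq_of_subset_of_card_le (Finset.filter_subset _ _)
      (by rw [(mem_kind.1 hz).2.1, hm])
    have hzc : dot (G.k z) c = 1 := (mem_through.1 (hz.symm ▸ hc)).2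
    have hzd : dot (G.k z) d = 1 := (mem_through.1 (hz.symm ▸ hd)).2
    refine not_adj_of_corner (hS hc) (hS hd) (dot_eq_one_of_mem (hS hc) (hS hd) hcd hzc hzd)
      hzc hzd huc hwd ?_ ?_ huw
    · rintro rfl
      exact hno ⟨d, hd, hzd, hwd⟩
    · rintro rfl
      exact hno ⟨c, hc, huc, hzc⟩
  have he := sum_edgeWeight_le_of_sharesLine hshare (M := V.offDiag)
    fun u hu w hw huw _ => Finset.mem_offDiag.2 ⟨hu, hw, huw⟩
  rw [Finset.offDiag_card, hVcard] at he
  norm_num at he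
  rw [potential, hw, hm, hk]
  push_cast
  linarith

/-- The potential of the right-angled pentagon all of whose corners are poles is nonnegative. -/
theorem IsLeaf.potential_nonneg_of_pentagon (hV : G.IsLeaf V L) (hm : L.card = 5)
    (hk : (orthPairs L).card = 10) (hp : (G.kind V L 2 2).card = 5) (hall : V ⊆ G.kind V L 2 2) :
    0 ≤ G.potential V L := by
  have hS := hV.subset
  have hVeq : V = G.kind V L 2 2 := hall.antisymm (Finset.filter_subset _ _)
  have hreg : 2 * L.card ≤ (orthPairs L).card := by rw [hm, hk]
  have hw : ∑ v ∈ V, G.vertexWeight L v = 135 := by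
    have h2 : ∀ v ∈ G.kind V L 2 2, G.vertexWeight L v = 27 := fun v hv => by
      rw [vertexWeight, (mem_kind.1 hv).2.1, (mem_kind.1 hv).2.2]; norm_num
    rw [Finset.sum_congr rfl fun v hv => h2 v (hall hv), Finset.sum_const, hVeq, hp]
    norm_num
  have hpair : ∀ v ∈ V, ∃ p ∈ L, ∃ q ∈ L, p ≠ q ∧ dot (G.k v) p = 1 ∧ dot (G.k v) q = 1 ∧
      ∀ x ∈ L, dot (G.k v) x = 1 → x = p ∨ x = q := by
    intro v hv
    obtain ⟨p, q, hpq, he⟩ := Finset.card_eq_two.1 (mem_kind.1 (hall hv)).2.1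
    have hmem : ∀ z, z ∈ L ∧ dot (G.k v) z = 1 ↔ z = p ∨ z = q := fun z => by
      rw [← mem_through, he, Finset.mem_insert, Finset.mem_singleton]
    have h1 := (hmem p).2 (.inl rfl)
    have h2 := (hmem q).2 (.inr rfl)
    exact ⟨p, h1.1, q, h2.1, hpq, h1.2, h2.2, fun x hx h => (hmem x).1 ⟨hx, h⟩⟩
  have hshare : ∀ u ∈ V, ∀ w ∈ V, G.adj u w → G.SharesLine L u w := by
    intro u hu w hw huw
    by_contra hno
    have hno' : ∀ x ∈ L, dot (G.k u) x = 1 → dot (G.k w) x ≠ 1 := fun x hx h1 h2 =>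
      hno ⟨x, hx, h1, h2⟩
    obtain ⟨p, hpL, q, hqL, hpq, hup, huq, -⟩ := hpair u hu
    obtain ⟨r, hrL, s, hsL, hrs, hwr, hws, -⟩ := hpair w hw
    have hne : ∀ {x y}, x ∈ L → dot (G.k u) x = 1 → dot (G.k w) y = 1 → x ≠ y := by
      rintro x _ hx h1 h2 rfl
      exact hno' x hx h1 h2
    obtain ⟨x, y, hx, hy, hxy⟩ := hV.exists_orth_of_card_le_five hreg hm.le hpL hqL hrL hsL
      (dot_eq_one_of_mem (hS hpL) (hS hqL) hpq hup huq)
      (dot_eq_one_of_mem (hS hrL) (hS hsL) hrs hwr hws)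
      (hne hpL hup hwr) (hne hpL hup hws) (hne hqL huq hwr) (hne hqL huq hws)
    have hx' : x ∈ L ∧ dot (G.k u) x = 1 := by rcases hx with rfl | rfl <;> exact ⟨‹_›, ‹_›⟩
    have hy' : y ∈ L ∧ dot (G.k w) y = 1 := by rcases hy with rfl | rfl <;> exact ⟨‹_›, ‹_›⟩
    obtain ⟨z, hzx, hzy⟩ := exists_corner (V := V) hS (by rw [hk, hp]) hx'.1 hy'.1 hxy
    refine not_adj_of_corner (hS hx'.1) (hS hy'.1) hxy hzx hzy hx'.2 hy'.2 ?_ ?_ huw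
    · rintro rfl
      exact hno' y hy'.1 hzy hy'.2
    · rintro rfl
      exact hno' x hx'.1 hx'.2 hzx
  have hn : ∀ c ∈ L, (G.onLine V c).card ≤ 2 := by
    intro c hc
    rw [← hV.card_perps_eq hreg hc]
    have hex : ∀ v ∈ G.onLine V c, ∃ b ∈ L, c ≠ b ∧ dot (G.k v) b = 1 := by
      intro v hv
      obtain ⟨p, hpL, q, hqL, hpq, hup, huq, -⟩ := hpair v (mem_onLine.1 hv).1
      by_cases h : c = p
      · exact ⟨q, hqL, h ▸ hpq, huq⟩
      · exact ⟨p, hpL, h, hup⟩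
    choose! f hfL hfc hfv using hex
    refine Finset.card_le_card_of_injOn f (fun v hv => mem_perps.2 ⟨hfL v hv,
      dot_eq_one_of_mem (hS hc) (hS (hfL v hv)) (hfc v hv) (mem_onLine.1 hv).2 (hfv v hv)⟩) ?_
    intro v hv w hw h
    exact eq_of_mem_of_mem (hS hc) (hS (hfL v hv)) (hfc v hv) (mem_onLine.1 hv).2 (hfv v hv)
      (mem_onLine.1 hw).2 (h ▸ hfv w hw)
  have he := sum_edgeWeight_le_of_sharesLine hshare
    (M := L.biUnion fun c => (G.onLine V c).offDiag)
    (by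
      rintro u hu w hw huw ⟨c, hc, h1, h2⟩
      exact Finset.mem_biUnion.2 ⟨c, hc, Finset.mem_offDiag.2
        ⟨mem_onLine.2 ⟨hu, h1⟩, mem_onLine.2 ⟨hw, h2⟩, huw⟩⟩)
  have hM : (L.biUnion fun c => (G.onLine V c).offDiag).card ≤ 5 * 2 := by
    rw [← hm]
    refine Finset.card_biUnion_le_card_mul _ _ _ fun c hc => ?_
    have := hn c hc
    rw [Finset.offDiag_card]
    generalize (G.onLine V c).card = n at *
    interval_cases n <;> norm_num
  rify at hM
  rw [potential, hw, hm, hk]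
  push_cast
  linarith

theorem IsLeaf.potential_nonneg (hV : G.IsLeaf V L)
    (h : ∃ c ∈ L, ∃ v ∈ V, dot (G.k v) c ≠ 1) : 0 ≤ G.potential V L := by
  have hS := hV.subset
  obtain ⟨c, hc, v, hv, hvc⟩ := h
  obtain ⟨w, hw, hwc⟩ := hV.occupied c hc
  have h2 : 2 ≤ V.card := Finset.one_lt_card.2 ⟨v, hv, w, hw, fun e => hvc (e ▸ hwc)⟩
  have e1 := hV.le_potential h2
  have e2 := sum_leafWeight_ge (V := V) hS
  have e3 := two_mul_card_kind_le (V := V) hS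
  have e4 := hV.card_kind_add_le
  obtain ⟨k, hk⟩ := even_card_orthPairs hS
  have hm1 : L.card = 1 → 1 ≤ (V.filter fun v => (G.through L v).card = 0).card := by
    intro h1
    refine Finset.card_pos.2 ⟨v, Finset.mem_filter.2 ⟨hv, Finset.card_eq_zero.2 ?_⟩⟩
    refine Finset.eq_empty_of_forall_notMem fun d hd => hvc ?_
    rw [mem_through] at hd
    rw [Finset.card_le_one.1 h1.le c hc d hd.1]
    exact hd.2
  have hm5 : L.card ≤ k → 5 ≤ L.card := fun h => hV.five_le_card ⟨c, hc⟩ (by omega)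
  have hm0 : 0 < L.card := Finset.card_pos.2 ⟨c, hc⟩
  have hempty : (V.filter fun v => (G.through L v).card = 0).card = 0 →
      (G.kind V L 1 1).card = 0 → V ⊆ G.kind V L 1 2 ∪ G.kind V L 2 2 := by
    intro h1 h2 u hu
    rw [Finset.card_eq_zero] at h1 h2
    have a1 : u ∉ V.filter fun v => (G.through L v).card = 0 := h1 ▸ Finset.notMem_empty u
    have a2 : u ∉ G.kind V L 1 1 := h2 ▸ Finset.notMem_empty u
    rw [Finset.mem_filter] at a1
    rw [mem_kind] at a2
    rw [Finset.mem_union, mem_kind, mem_kind]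
    have h3 := card_through_le hS u
    have h4 := G.card_through_lines_le u
    simp only [hu, true_and] at a1 a2 ⊢
    omega
  generalize ha : (V.filter fun v => (G.through L v).card = 0).card = a at *
  generalize hc1 : (G.kind V L 1 1).card = c1 at *
  generalize hf : (G.kind V L 1 2).card = f at *
  generalize hp : (G.kind V L 2 2).card = p at *
  generalize hm : L.card = m at *
  rw [hk] at e1 e3 e4
  have key : (0 : ℤ) ≤ 20 * a + 10 * c1 - 12 * f - 17 * p + 84 * m - 53 * k - 80 ∨
      (m = 2 ∧ k = 1 ∧ f = 2 ∧ p = 1 ∧ a = 0 ∧ c1 = 0) ∨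
      (m = 5 ∧ k = 5 ∧ f = 0 ∧ p = 5 ∧ a = 0 ∧ c1 = 0) := by omega
  rcases key with h | ⟨rfl, rfl, rfl, rfl, rfl, rfl⟩ | ⟨rfl, rfl, rfl, rfl, rfl, rfl⟩
  · rify at h
    push_cast at e1
    linarith
  · exact hV.potential_nonneg_of_corner hm hk hf hp (hempty rfl rfl)
  · refine hV.potential_nonneg_of_pentagon hm hk hp ?_
    rw [Finset.card_eq_zero] at hf
    simpa only [hf, Finset.empty_union] using hempty rfl rfl

/-- A region cut by one of its occupied lines has nonnegative potential as soon as this holds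
for all smaller regions with a nondegenerate boundary. -/
theorem IsRegion.potential_nonneg_of_cut (hV : G.IsRegion V L) {b : ℝ × ℝ} (hb : b ∈ G.lines)
    (ho : ∃ v ∈ V, dot (G.k v) b = 1) (hs : ¬G.Supports V b)
    (ih : ∀ (W : Finset ι) (M : Finset (ℝ × ℝ)), W.card < V.card → G.IsRegion W M →
      (∃ c ∈ M, ∃ v ∈ W, dot (G.k v) c ≠ 1) → 0 ≤ G.potential W M) : 0 ≤ G.potential V L := by
  have hbL : b ∉ L := fun h => hs (hV.supports b h)
  obtain ⟨v, hv, hvb⟩ := ho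
  rw [Supports, not_or] at hs
  push Not at hs
  obtain ⟨⟨x, hx, hxb⟩, y, hy, hyb⟩ := hs
  refine le_trans (add_nonneg
    (ih _ _ ?_ (hV.insert_restrict (Finset.filter_subset _ _) hb ?_ ?_) ?_)
    (ih _ _ ?_ (hV.insert_restrict (Finset.filter_subset _ _) hb ?_ ?_) ?_))
    (hV.potential_cut hb hbL ⟨v, hv, hvb⟩)
  · exact Finset.card_lt_card (Finset.filter_ssubset.2 ⟨y, hy, hyb.not_ge⟩)
  · exact .inr fun w hw => (Finset.mem_filter.1 hw).2
  · exact ⟨v, Finset.mem_filter.2 ⟨hv, hvb.ge⟩, hvb⟩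
  · exact ⟨b, Finset.mem_insert_self _ _, x, Finset.mem_filter.2 ⟨hx, hxb.le⟩, hxb.ne'⟩
  · exact Finset.card_lt_card (Finset.filter_ssubset.2 ⟨x, hx, hxb.not_ge⟩)
  · exact .inl fun w hw => (Finset.mem_filter.1 hw).2
  · exact ⟨v, Finset.mem_filter.2 ⟨hv, hvb.le⟩, hvb⟩
  · exact ⟨b, Finset.mem_insert_self _ _, y, Finset.mem_filter.2 ⟨hy, hyb.le⟩, hyb.ne⟩

/-- The potential of a region with a nondegenerate boundary is nonnegative. -/
theorem IsRegion.potential_nonneg (hV : G.IsRegion V L)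
    (h : ∃ c ∈ L, ∃ v ∈ V, dot (G.k v) c ≠ 1) : 0 ≤ G.potential V L := by
  induction hn : V.card using Nat.strong_induction_on generalizing V L with
  | _ n ih =>
    by_cases hleaf : ∀ b ∈ G.lines, (∃ v ∈ V, dot (G.k v) b = 1) → G.Supports V b
    · exact IsLeaf.potential_nonneg ⟨hV, hleaf⟩ h
    push Not at hleaf
    obtain ⟨b, hb, ho, hs⟩ := hleaf
    exact hV.potential_nonneg_of_cut hb ho hs fun W M hW hM hWM => ih _ (hn ▸ hW) hM hWM rfl

/-- The main inequality: adjacencies and incidences with the lines are few. -/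
theorem adj_add_incidence_le (V : Finset ι) (hne : V.Nonempty) :
    22 * ((V ×ˢ V).filter fun e => G.adj e.1 e.2).card +
      44 * ∑ v ∈ V, (G.through G.lines v).card ≤ 196 * V.card := by
  have hV : G.IsRegion V ∅ := ⟨Finset.empty_subset _, by simp, by simp⟩
  have hpot : G.potential V ∅ = 196 * V.card - 44 * ∑ v ∈ V, ((G.through G.lines v).card : ℝ) -
      22 * ((V ×ˢ V).filter fun e => G.adj e.1 e.2).card - 212 := by
    have h1 : ∀ v ∈ V, G.vertexWeight ∅ v = 196 - 44 * ((G.through G.lines v).card : ℝ) := by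
      intro v _
      rw [vertexWeight, through, Finset.filter_empty, Finset.card_empty, pow_zero, one_mul]
    have h2 : ∀ e ∈ V ×ˢ V, G.edgeWeight ∅ e.1 e.2 = 22 * if G.adj e.1 e.2 then 1 else 0 := by
      intro e _
      have : ¬G.SharesLine ∅ e.1 e.2 := by simp [SharesLine]
      rw [edgeWeight, if_neg this]
      split_ifs <;> norm_num
    rw [potential, Finset.sum_congr rfl h1, ← Finset.sum_product', Finset.sum_congr rfl h2,
      ← Finset.mul_sum, Finset.sum_boole, Finset.sum_sub_distrib, ← Finset.mul_sum]
    simp [orthPairs]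
    ring
  suffices h : 22 * (((V ×ˢ V).filter fun e => G.adj e.1 e.2).card : ℝ) +
      44 * ∑ v ∈ V, ((G.through G.lines v).card : ℝ) ≤ 196 * V.card by exact_mod_cast h
  by_cases hleaf : ∀ b ∈ G.lines, (∃ v ∈ V, dot (G.k v) b = 1) → G.Supports V b
  · by_cases h2 : 2 ≤ V.card
    · have e1 := IsLeaf.le_potential ⟨hV, hleaf⟩ h2
      have e2 := sum_leafWeight_ge (V := V) (Finset.empty_subset G.lines)
      have hz : ∀ j, (G.kind V ∅ 1 j).card = 0 ∧ (G.kind V ∅ 2 j).card = 0 := by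
        intro j
        simp [kind, through]
      rw [(hz 1).1, (hz 2).1, (hz 2).2] at e2
      simp only [Finset.card_empty, orthPairs, Finset.empty_product, Finset.filter_empty] at e1
      have : (0 : ℝ) ≤ ((V.filter fun v => (G.through ∅ v).card = 0).card : ℝ) := by positivity
      push_cast at e1 e2
      linarith
    · have h1 : V.card = 1 := by have := hne.card_pos; omega
      obtain ⟨v, rfl⟩ := Finset.card_eq_one.1 h1
      have h3 := G.card_through_lines_le v
      have h4 : ¬G.adj v v := fun h => G.adj_ne _ _ h rfl
      rify at h3
      simp [Finset.filter_singleton, h4]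
      linarith
  · push Not at hleaf
    obtain ⟨b, hb, ho, hs⟩ := hleaf
    have := hV.potential_nonneg_of_cut hb ho hs fun W M _ hM hWM => hM.potential_nonneg hWM
    rw [hpot] at this
    linarith

end Klein.Config

namespace Circ

theorem dist_sq_eq (x y : EuclideanSpace ℝ (Fin 2)) :
    dist x y ^ 2 = (x 0 - y 0) ^ 2 + (x 1 - y 1) ^ 2 := by
  rw [EuclideanSpace.dist_sq_eq]
  simp [Fin.sum_univ_two, Real.dist_eq, sq_abs]

theorem ext_center_radius {A B : Circ} (h : dist A.center B.center = 0)
    (hr : A.radius = B.radius) : A = B := by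
  cases A; cases B
  simp only [dist_eq_zero] at h
  simp_all

theorem Intersects.symm {A B : Circ} (h : Intersects A B) : Intersects B A := by
  rwa [Intersects, Set.inter_comm]

theorem Intersects.dist_le {A B : Circ} (h : Intersects A B) :
    dist A.center B.center ≤ A.radius + B.radius := by
  obtain ⟨p, hA, hB⟩ := h
  have hA : dist p A.center = A.radius := hA
  have hB : dist p B.center = B.radius := hB
  rw [← hA, ← hB]
  exact dist_triangle_left _ _ _

theorem Intersects.sub_le {A B : Circ} (h : Intersects A B) :
    A.radius - B.radius ≤ dist A.center B.center := by
  obtain ⟨p, hA, hB⟩ := h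
  have hA : dist p A.center = A.radius := hA
  have hB : dist p B.center = B.radius := hB
  have := dist_triangle_right p A.center B.center
  linarith

theorem intersects_of_dist {A B : Circ} (h₁ : A.radius - B.radius ≤ dist A.center B.center)
    (h₂ : B.radius - A.radius ≤ dist A.center B.center)
    (h₃ : dist A.center B.center ≤ A.radius + B.radius) : Intersects A B := by
  have hA := A.radius_pos
  have hB := B.radius_pos
  rcases (dist_nonneg (x := A.center) (y := B.center)).eq_or_lt with hd | hd
  · have hAB : A = B := ext_center_radius hd.symm (by linarith)
    subst hAB
    rw [Intersects, Set.inter_self]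
    exact NormedSpace.sphere_nonempty.2 hA.le
  · set d := dist A.center B.center with hdd
    have hsq : d ^ 2 = (A.center 0 - B.center 0) ^ 2 + (A.center 1 - B.center 1) ^ 2 :=
      dist_sq_eq _ _
    obtain ⟨a, ha⟩ : ∃ a, a = (d ^ 2 + A.radius ^ 2 - B.radius ^ 2) / (2 * d ^ 2) := ⟨_, rfl⟩
    obtain ⟨h, hh⟩ : ∃ h : ℝ, h ^ 2 = A.radius ^ 2 / d ^ 2 - a ^ 2 := by
      refine ⟨√(A.radius ^ 2 / d ^ 2 - a ^ 2), Real.sq_sqrt ?_⟩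
      have e : A.radius ^ 2 / d ^ 2 - a ^ 2 = ((B.radius ^ 2 - (d - A.radius) ^ 2) *
          ((d + A.radius) ^ 2 - B.radius ^ 2)) / (4 * d ^ 4) := by
        rw [ha]; field_simp; ring
      rw [e]
      refine div_nonneg (mul_nonneg ?_ ?_) (by positivity) <;> nlinarith
    have ha' : a * (2 * d ^ 2) = d ^ 2 + A.radius ^ 2 - B.radius ^ 2 := by
      rw [ha]; field_simp
    have hh' : (a ^ 2 + h ^ 2) * d ^ 2 = A.radius ^ 2 := by
      rw [hh]; field_simp; ring
    refine ⟨!₂[A.center 0 + a * (B.center 0 - A.center 0) - h * (B.center 1 - A.center 1),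
      A.center 1 + a * (B.center 1 - A.center 1) + h * (B.center 0 - A.center 0)], ?_, ?_⟩
    · rw [points, Metric.mem_sphere, ← sq_eq_sq₀ dist_nonneg hA.le, dist_sq_eq, ← hh', hsq]
      simp
      ring
    · rw [points, Metric.mem_sphere, ← sq_eq_sq₀ dist_nonneg hB.le, dist_sq_eq]
      have : B.radius ^ 2 = (a ^ 2 + h ^ 2) * d ^ 2 - a * (2 * d ^ 2) + d ^ 2 := by
        rw [hh', ha']; ring
      rw [this, hsq]
      simp
      ring

/-- Two circles that do not meet are outside one another or nested. -/
theorem lt_of_not_intersects {A B : Circ} (h : ¬Intersects A B) :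
    A.radius + B.radius < dist A.center B.center ∨
      dist A.center B.center < A.radius - B.radius ∨
        dist A.center B.center < B.radius - A.radius := by
  by_contra! hc
  exact h (intersects_of_dist hc.2.1 hc.2.2 hc.1)

/-- `S` is a family of pairwise incomparable circles inside the disc of centre `o` and radius `R`,
all of whose other neighbours in `𝒜` are orthogonal to the boundary of the disc. -/
structure IsDisc (𝒜 S : Finset Circ) (o : EuclideanSpace ℝ (Fin 2)) (R : ℝ) : Prop where
  subset : S ⊆ 𝒜
  nonempty : S.Nonempty
  orth : (𝒜 : Set Circ).Pairwise fun X Y => Intersects X Y → Orthogonal X Y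
  inside : ∀ s ∈ S, dist s.center o < R - s.radius
  incomparable : ∀ s ∈ S, ∀ t ∈ S, t.radius - s.radius ≤ dist s.center t.center
  boundary : ∀ w ∈ 𝒜, w ∉ S → ∀ s ∈ S, Intersects w s →
    dist w.center o ^ 2 = w.radius ^ 2 + R ^ 2

theorem exists_isDisc {𝒜 : Finset Circ} (hne : 𝒜.Nonempty)
    (ho : (𝒜 : Set Circ).Pairwise fun X Y => Intersects X Y → Orthogonal X Y) :
    ∃ S o R, IsDisc 𝒜 S o R := by
  by_cases hc : ∃ C ∈ 𝒜, ∃ A ∈ 𝒜, dist A.center C.center < C.radius - A.radius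
  · obtain ⟨C, hC, hmin⟩ := Finset.exists_min_image
      (𝒜.filter fun C => ∃ A ∈ 𝒜, dist A.center C.center < C.radius - A.radius) Circ.radius
      (by obtain ⟨C, hC, h⟩ := hc; exact ⟨C, Finset.mem_filter.2 ⟨hC, h⟩⟩)
    obtain ⟨hC, A, hA, hAC⟩ := Finset.mem_filter.1 hC
    refine ⟨𝒜.filter fun s => dist s.center C.center < C.radius - s.radius, C.center, C.radius,
      Finset.filter_subset _ _, ⟨A, Finset.mem_filter.2 ⟨hA, hAC⟩⟩, ho,
      fun s hs => (Finset.mem_filter.1 hs).2, ?_, ?_⟩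
    · intro s hs t ht
      by_contra! hlt
      obtain ⟨hs, -⟩ := Finset.mem_filter.1 hs
      obtain ⟨ht, htC⟩ := Finset.mem_filter.1 ht
      have h1 := hmin t (Finset.mem_filter.2 ⟨ht, s, hs, hlt⟩)
      have h2 := dist_nonneg (x := t.center) (y := C.center)
      linarith
    · intro w hw hwS s hs hws
      obtain ⟨hs, hsC⟩ := Finset.mem_filter.1 hs
      have hwC : C.radius - w.radius ≤ dist w.center C.center := by
        by_contra! hlt
        exact hwS (Finset.mem_filter.2 ⟨hw, hlt⟩)
      have h1 := hws.dist_le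
      have h2 := hws.sub_le
      have h3 := dist_triangle w.center s.center C.center
      have h4 := dist_triangle w.center C.center s.center
      rw [dist_comm C.center s.center] at h4
      have h5 : w ≠ C := by
        rintro rfl
        rw [dist_comm] at hsC
        linarith
      have h6 := s.radius_pos
      exact (ho hw hC h5 (intersects_of_dist (by linarith) hwC (by linarith))).2
  · push Not at hc
    refine ⟨𝒜, 0, 1 + ∑ s ∈ 𝒜, (dist s.center 0 + s.radius), subset_rfl, hne, ho, ?_,
      fun s hs t ht => hc t ht s hs, fun w hw hw' => absurd hw hw'⟩
    intro s hs
    have := Finset.single_le_sum (f := fun s : Circ => dist s.center 0 + s.radius)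
      (fun t _ => add_nonneg dist_nonneg t.radius_pos.le) hs
    linarith

open Klein

variable (o : EuclideanSpace ℝ (Fin 2)) (R : ℝ)

/-- The power of the point `o` with respect to a circle. -/
noncomputable def power (s : Circ) : ℝ := dist s.center o ^ 2 - s.radius ^ 2

/-- The position of `s` in the Klein model of the disc of centre `o` and radius `R`, rescaled to
the unit disc. -/
noncomputable def pole (s : Circ) : ℝ × ℝ :=
  (2 * R * (s.center 0 - o 0) / (R ^ 2 + power o s),
    2 * R * (s.center 1 - o 1) / (R ^ 2 + power o s))

/-- The weight of `s` in the Klein model of the disc of centre `o` and radius `R`. -/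
noncomputable def weight (s : Circ) : ℝ := (R ^ 2 - power o s) / (R ^ 2 + power o s)

/-- The centre of `w` after rescaling the disc of centre `o` and radius `R` to the unit disc. -/
noncomputable def rescaledCenter (w : Circ) : ℝ × ℝ :=
  ((w.center 0 - o 0) / R, (w.center 1 - o 1) / R)

variable {o R}

theorem power_eq (s : Circ) :
    power o s = (s.center 0 - o 0) ^ 2 + (s.center 1 - o 1) ^ 2 - s.radius ^ 2 := by
  rw [power, dist_sq_eq]

theorem one_sub_dot_sub_weight {s t : Circ} (hs : 0 < R ^ 2 + power o s)
    (ht : 0 < R ^ 2 + power o t) :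
    1 - dot (pole o R s) (pole o R t) - weight o R s * weight o R t =
      2 * R ^ 2 * (dist s.center t.center ^ 2 - s.radius ^ 2 - t.radius ^ 2) /
        ((R ^ 2 + power o s) * (R ^ 2 + power o t)) := by
  simp only [dot, pole, weight]
  field_simp
  rw [dist_sq_eq, power_eq, power_eq]
  ring

theorem dot_pole_sub_one {s w : Circ} (hR : 0 < R) (hs : 0 < R ^ 2 + power o s)
    (hw : dist w.center o ^ 2 = w.radius ^ 2 + R ^ 2) :
    dot (pole o R s) (rescaledCenter o R w) - 1 =
      (s.radius ^ 2 + w.radius ^ 2 - dist s.center w.center ^ 2) / (R ^ 2 + power o s) := by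
  simp only [dot, pole, rescaledCenter]
  field_simp
  rw [dist_sq_eq] at hw ⊢
  rw [power_eq]
  linear_combination hw

theorem dot_rescaledCenter_sub_one {w w' : Circ} (hR : 0 < R)
    (hw : dist w.center o ^ 2 = w.radius ^ 2 + R ^ 2)
    (hw' : dist w'.center o ^ 2 = w'.radius ^ 2 + R ^ 2) :
    dot (rescaledCenter o R w) (rescaledCenter o R w') - 1 =
      (w.radius ^ 2 + w'.radius ^ 2 - dist w.center w'.center ^ 2) / (2 * R ^ 2) := by
  simp only [dot, rescaledCenter]
  field_simp
  rw [dist_sq_eq] at hw hw' ⊢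
  linear_combination hw + hw'

theorem rescaledCenter_injOn {w w' : Circ} (hR : 0 < R)
    (hw : dist w.center o ^ 2 = w.radius ^ 2 + R ^ 2)
    (hw' : dist w'.center o ^ 2 = w'.radius ^ 2 + R ^ 2)
    (h : rescaledCenter o R w = rescaledCenter o R w') : w = w' := by
  simp only [rescaledCenter, Prod.mk.injEq, div_left_inj' hR.ne', sub_left_inj] at h
  have hc : w.center = w'.center := by
    ext i
    fin_cases i
    exacts [h.1, h.2]
  refine ext_center_radius (by rw [hc, dist_self]) ?_
  rw [hc, hw'] at hw
  exact ((sq_eq_sq₀ w'.radius_pos.le w.radius_pos.le).1 (by linarith)).symm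

namespace IsDisc

variable {𝒜 S : Finset Circ} {o : EuclideanSpace ℝ (Fin 2)} {R : ℝ}

/-- The circles orthogonal to the boundary of the disc, apart from those of `S`. -/
noncomputable def boundaryCircles (𝒜 S : Finset Circ) (o : EuclideanSpace ℝ (Fin 2)) (R : ℝ) :
    Finset Circ :=
  (𝒜 \ S).filter fun w => dist w.center o ^ 2 = w.radius ^ 2 + R ^ 2

theorem radius_pos (h : IsDisc 𝒜 S o R) : 0 < R := by
  obtain ⟨s, hs⟩ := h.nonempty
  linarith [h.inside s hs, s.radius_pos, dist_nonneg (x := s.center) (y := o)]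

theorem add_power_pos (h : IsDisc 𝒜 S o R) {s : Circ} (hs : s ∈ S) : 0 < R ^ 2 + power o s := by
  have h1 := h.inside s hs
  have h2 := s.radius_pos
  have h3 := dist_nonneg (x := s.center) (y := o)
  rw [power]
  nlinarith

theorem dist_sq_of_intersects (h : IsDisc 𝒜 S o R) {s t : Circ} (hs : s ∈ 𝒜) (ht : t ∈ 𝒜)
    (hst : s ≠ t) (hi : Intersects s t) :
    dist s.center t.center ^ 2 = s.radius ^ 2 + t.radius ^ 2 :=
  (h.orth hs ht hst hi).2

theorem le_dist_sq (h : IsDisc 𝒜 S o R) {s t : Circ} (hs : s ∈ S) (ht : t ∈ S) (hst : s ≠ t) :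
    s.radius ^ 2 + t.radius ^ 2 ≤ dist s.center t.center ^ 2 := by
  by_cases hi : Intersects s t
  · exact (h.dist_sq_of_intersects (h.subset hs) (h.subset ht) hst hi).ge
  · have h1 := h.incomparable s hs t ht
    have h2 := h.incomparable t ht s hs
    rw [dist_comm] at h2
    have h3 := s.radius_pos
    have h4 := t.radius_pos
    rcases lt_of_not_intersects hi with h5 | h5 | h5 <;> nlinarith

theorem not_cross (h : IsDisc 𝒜 S o R) {s t w : Circ} (hs : s ∈ S) (ht : t ∈ S)
    (hi : Intersects s t) (hw : w ∈ 𝒜) (hwS : w ∉ S)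
    (hwo : dist w.center o ^ 2 = w.radius ^ 2 + R ^ 2)
    (h1 : s.radius ^ 2 + w.radius ^ 2 < dist s.center w.center ^ 2)
    (h2 : dist t.center w.center ^ 2 < t.radius ^ 2 + w.radius ^ 2) : False := by
  have hR := h.radius_pos
  have p1 := s.radius_pos
  have p2 := t.radius_pos
  have p3 := w.radius_pos
  have q1 := dist_nonneg (x := s.center) (y := w.center)
  have q2 := dist_nonneg (x := t.center) (y := w.center)
  have hout : R - w.radius < dist w.center o := by
    have := dist_nonneg (x := w.center) (y := o)
    nlinarith
  have inside : ∀ x ∈ S, ¬dist x.center w.center < x.radius - w.radius := by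
    intro x hx hlt
    have a1 := h.inside x hx
    have a2 := dist_triangle w.center x.center o
    rw [dist_comm w.center x.center] at a2
    linarith
  have b1 : ¬Intersects s w := fun hc =>
    h1.ne' (h.dist_sq_of_intersects (h.subset hs) hw (by rintro rfl; exact hwS hs) hc)
  have b2 : ¬Intersects t w := fun hc =>
    h2.ne (h.dist_sq_of_intersects (h.subset ht) hw (by rintro rfl; exact hwS ht) hc)
  have c2 : dist t.center w.center < w.radius - t.radius := by
    rcases lt_of_not_intersects b2 with hc | hc | hc
    · nlinarith
    · exact absurd hc (inside t ht)
    · exact hc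
  have c1 : s.radius + w.radius < dist s.center w.center := by
    rcases lt_of_not_intersects b1 with hc | hc | hc
    · exact hc
    · exact absurd hc (inside s hs)
    · nlinarith
  have c3 := hi.dist_le
  have c4 := dist_triangle s.center t.center w.center
  linarith

theorem orthOrDisjoint (h : IsDisc 𝒜 S o R) {w w' : Circ} (hw : w ∈ boundaryCircles 𝒜 S o R)
    (hw' : w' ∈ boundaryCircles 𝒜 S o R) (hne : w ≠ w') :
    OrthOrDisjoint (rescaledCenter o R w) (rescaledCenter o R w') := by
  have hR := h.radius_pos
  obtain ⟨hw, hwo⟩ := Finset.mem_filter.1 hw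
  obtain ⟨hw', hwo'⟩ := Finset.mem_filter.1 hw'
  have e := dot_rescaledCenter_sub_one hR hwo hwo'
  by_cases hi : Intersects w w'
  · left
    rw [h.dist_sq_of_intersects (Finset.sdiff_subset hw) (Finset.sdiff_subset hw') hne hi,
      sub_self, zero_div] at e
    linarith
  · right
    rw [e, dot_rescaledCenter_sub_one hR hwo hwo, dot_rescaledCenter_sub_one hR hwo' hwo',
      dist_self, dist_self, div_mul_div_comm, div_pow, ← sq]
    refine div_lt_div_of_pos_right ?_ (by positivity)
    have p1 := w.radius_pos
    have p2 := w'.radius_pos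
    have p3 := dist_nonneg (x := w.center) (y := w'.center)
    have p4 := mul_pos p1 p2
    rcases lt_of_not_intersects hi with hc | hc | hc
    · have : 2 * (w.radius * w'.radius) <
        -(w.radius ^ 2 + w'.radius ^ 2 - dist w.center w'.center ^ 2) := by nlinarith
      nlinarith
    · have : 2 * (w.radius * w'.radius) <
        w.radius ^ 2 + w'.radius ^ 2 - dist w.center w'.center ^ 2 := by nlinarith
      nlinarith
    · have : 2 * (w.radius * w'.radius) <
        w.radius ^ 2 + w'.radius ^ 2 - dist w.center w'.center ^ 2 := by nlinarith
      nlinarith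

theorem weight_pos (h : IsDisc 𝒜 S o R) {s : Circ} (hs : s ∈ S) : 0 < weight o R s := by
  refine div_pos ?_ (h.add_power_pos hs)
  have h1 := h.inside s hs
  have h2 := s.radius_pos
  have h3 := dist_nonneg (x := s.center) (y := o)
  rw [power]
  nlinarith

theorem dot_pole_self_lt (h : IsDisc 𝒜 S o R) {s : Circ} (hs : s ∈ S) :
    dot (pole o R s) (pole o R s) < 1 := by
  have hM := h.add_power_pos hs
  have h1 := h.inside s hs
  have h2 := s.radius_pos
  have h3 := dist_nonneg (x := s.center) (y := o)
  have e : dot (pole o R s) (pole o R s) =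
      4 * R ^ 2 * dist s.center o ^ 2 / (R ^ 2 + power o s) ^ 2 := by
    simp only [dot, pole]
    field_simp
    rw [dist_sq_eq]
    ring
  rw [e, div_lt_one (by positivity)]
  have h4 : 2 * R * dist s.center o < R ^ 2 + power o s := by
    rw [power]
    nlinarith
  have h5 := h.radius_pos
  have := pow_lt_pow_left₀ h4 (by positivity) two_ne_zero
  linarith

theorem one_sub_dot_pole_self_lt (h : IsDisc 𝒜 S o R) {s : Circ} (hs : s ∈ S) :
    1 - dot (pole o R s) (pole o R s) < weight o R s ^ 2 := by
  have hM := h.add_power_pos hs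
  have e := one_sub_dot_sub_weight hM hM
  have h2 := s.radius_pos
  have h5 := h.radius_pos
  have : 2 * R ^ 2 * (dist s.center s.center ^ 2 - s.radius ^ 2 - s.radius ^ 2) /
      ((R ^ 2 + power o s) * (R ^ 2 + power o s)) < 0 := by
    refine div_neg_of_neg_of_pos (mul_neg_of_pos_of_neg (by positivity) ?_) (by positivity)
    rw [dist_self]
    nlinarith
  nlinarith

theorem weight_mul_le (h : IsDisc 𝒜 S o R) {s t : Circ} (hs : s ∈ S) (ht : t ∈ S) (hst : s ≠ t) :
    weight o R s * weight o R t ≤ 1 - dot (pole o R s) (pole o R t) := by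
  rw [← sub_nonneg, one_sub_dot_sub_weight (h.add_power_pos hs) (h.add_power_pos ht)]
  refine div_nonneg (mul_nonneg (by positivity) ?_)
    (mul_pos (h.add_power_pos hs) (h.add_power_pos ht)).le
  linarith [h.le_dist_sq hs ht hst]

theorem weight_mul_eq (h : IsDisc 𝒜 S o R) {s t : Circ} (hs : s ∈ S) (ht : t ∈ S) (hst : s ≠ t)
    (hi : Intersects s t) :
    weight o R s * weight o R t = 1 - dot (pole o R s) (pole o R t) := by
  have e := one_sub_dot_sub_weight (h.add_power_pos hs) (h.add_power_pos ht)
  rw [h.dist_sq_of_intersects (h.subset hs) (h.subset ht) hst hi] at e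
  simp only [add_sub_cancel_left, sub_self, mul_zero, zero_div] at e
  linarith

theorem dot_pole_eq_one (h : IsDisc 𝒜 S o R) {s w : Circ} (hs : s ∈ S)
    (hw : w ∈ boundaryCircles 𝒜 S o R) (hi : Intersects w s) :
    dot (pole o R s) (rescaledCenter o R w) = 1 := by
  obtain ⟨hw, hwo⟩ := Finset.mem_filter.1 hw
  obtain ⟨hw, hwS⟩ := Finset.mem_sdiff.1 hw
  have e := dot_pole_sub_one h.radius_pos (h.add_power_pos hs) hwo
  rw [h.dist_sq_of_intersects (h.subset hs) hw (by rintro rfl; exact hwS hs) hi.symm,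
    sub_self, zero_div] at e
  linarith

/-- The configuration seen in the Klein model of the disc. -/
noncomputable def toConfig (h : IsDisc 𝒜 S o R) : Config S where
  k s := pole o R s
  g s := weight o R s
  adj s t := s ≠ t ∧ Intersects (s : Circ) t
  lines := (boundaryCircles 𝒜 S o R).image (rescaledCenter o R)
  g_pos s := h.weight_pos s.2
  norm_lt s := h.dot_pole_self_lt s.2
  one_sub_norm_lt s := h.one_sub_dot_pole_self_lt s.2
  mul_le s t hst := h.weight_mul_le s.2 t.2 (Subtype.coe_ne_coe.2 hst)
  mul_eq s t hst := h.weight_mul_eq s.2 t.2 (Subtype.coe_ne_coe.2 hst.1) hst.2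
  adj_symm _ _ hst := ⟨hst.1.symm, hst.2.symm⟩
  adj_ne _ _ hst := hst.1
  adj_side s t hst c hc := by
    obtain ⟨w, hw, rfl⟩ := Finset.mem_image.1 hc
    obtain ⟨hw, hwo⟩ := Finset.mem_filter.1 hw
    obtain ⟨hw, hwS⟩ := Finset.mem_sdiff.1 hw
    rw [← sub_neg, ← sub_pos (a := dot (pole o R t) _),
      dot_pole_sub_one h.radius_pos (h.add_power_pos s.2) hwo,
      dot_pole_sub_one h.radius_pos (h.add_power_pos t.2) hwo,
      div_lt_iff₀ (h.add_power_pos s.2), lt_div_iff₀ (h.add_power_pos t.2), zero_mul, zero_mul]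
    rintro ⟨h1, h2⟩
    exact h.not_cross s.2 t.2 hst.2 hw hwS hwo (by linarith) (by linarith)
  one_lt c hc := by
    obtain ⟨w, hw, rfl⟩ := Finset.mem_image.1 hc
    obtain ⟨hw, hwo⟩ := Finset.mem_filter.1 hw
    have hR := h.radius_pos
    have p := w.radius_pos
    rw [← sub_pos, dot_rescaledCenter_sub_one hR hwo hwo, dist_self]
    refine div_pos ?_ (by positivity)
    nlinarith
  orth_or_disjoint c hc d hd hcd := by
    obtain ⟨w, hw, rfl⟩ := Finset.mem_image.1 hc
    obtain ⟨w', hw', rfl⟩ := Finset.mem_image.1 hd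
    exact h.orthOrDisjoint hw hw' fun e => hcd (by rw [e])

theorem card_intersects_le (h : IsDisc 𝒜 S o R) (s : S) :
    ((boundaryCircles 𝒜 S o R).filter fun w => Intersects w (s : Circ)).card ≤
      (h.toConfig.through h.toConfig.lines s).card := by
  refine Finset.card_le_card_of_injOn (rescaledCenter o R) (fun w hw => ?_) fun w hw w' hw' e => ?_
  · obtain ⟨hw, hi⟩ := Finset.mem_filter.1 hw
    exact Finset.mem_filter.2 ⟨Finset.mem_image_of_mem _ hw, h.dot_pole_eq_one s.2 hw hi⟩
  · have hw := (Finset.mem_filter.1 (Finset.mem_filter.1 hw).1).2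
    have hw' := (Finset.mem_filter.1 (Finset.mem_filter.1 hw').1).2
    exact rescaledCenter_injOn h.radius_pos hw hw' e

theorem two_mul_incCount_le (h : IsDisc 𝒜 S o R) :
    2 * incCount 𝒜 S ≤
      ((Finset.univ ×ˢ Finset.univ).filter fun e => h.toConfig.adj e.1 e.2).card +
        2 * ∑ s, (h.toConfig.through h.toConfig.lines s).card := by
  set T := (Finset.univ ×ˢ Finset.univ).filter fun e => h.toConfig.adj e.1 e.2 with hT
  set I := T.image fun e => ({(e.1 : Circ), (e.2 : Circ)} : Finset Circ) with hI
  set J := Finset.univ.biUnion fun s : S => ((boundaryCircles 𝒜 S o R).filter fun w =>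
    Intersects w (s : Circ)).image fun w => ({(s : Circ), w} : Finset Circ) with hJ
  have hIcard : 2 * I.card ≤ T.card := by
    refine Finset.mul_card_image_le_card_of_maps_to (f := fun e : S × S =>
      ({(e.1 : Circ), (e.2 : Circ)} : Finset Circ)) (fun e he => Finset.mem_image_of_mem _ he) 2 ?_
    intro p hp
    obtain ⟨⟨s, t⟩, he, rfl⟩ := Finset.mem_image.1 hp
    have hst := (Finset.mem_filter.1 he).2
    rw [← Finset.card_pair (show (s, t) ≠ (t, s) from fun e => hst.1 (Prod.mk.inj e).1)]
    refine Finset.card_le_card fun q hq => ?_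
    rcases Finset.mem_insert.1 hq with rfl | hq
    · exact Finset.mem_filter.2 ⟨he, rfl⟩
    · rw [Finset.mem_singleton.1 hq]
      exact Finset.mem_filter.2 ⟨Finset.mem_filter.2
        ⟨by simp, h.toConfig.adj_symm _ _ hst⟩, Finset.pair_comm _ _⟩
  have hJcard : J.card ≤ ∑ s, (h.toConfig.through h.toConfig.lines s).card :=
    Finset.card_biUnion_le.trans <| Finset.sum_le_sum fun s _ =>
      Finset.card_image_le.trans (h.card_intersects_le s)
  have key : ∀ A ∈ S, ∀ B ∈ 𝒜, A ≠ B → Intersects A B → ({A, B} : Finset Circ) ∈ I ∪ J := by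
    intro A hA B hB hAB hi
    by_cases hBS : B ∈ S
    · exact Finset.mem_union_left _ (Finset.mem_image.2 ⟨(⟨A, hA⟩, ⟨B, hBS⟩),
        Finset.mem_filter.2 ⟨by simp, fun e => hAB (congrArg Subtype.val e), hi⟩, rfl⟩)
    · refine Finset.mem_union_right _ (Finset.mem_biUnion.2 ⟨⟨A, hA⟩, Finset.mem_univ _,
        Finset.mem_image.2 ⟨B, Finset.mem_filter.2 ⟨Finset.mem_filter.2
          ⟨Finset.mem_sdiff.2 ⟨hB, hBS⟩, h.boundary B hB hBS A hA hi.symm⟩, hi.symm⟩, rfl⟩⟩)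
  have hsub : incCount 𝒜 S ≤ (I ∪ J).card := by
    refine Finset.card_le_card fun e he => ?_
    obtain ⟨he, ⟨A, hA, B, hB, hAB, hi⟩, C, hC, hCS⟩ := Finset.mem_filter.1 he
    obtain ⟨he𝒜, hcard⟩ := Finset.mem_powersetCard.1 he
    have heq : e = {A, B} := (Finset.eq_of_subset_of_card_le (by grind)
      (by rw [hcard, Finset.card_pair hAB])).symm
    subst heq
    rcases Finset.mem_insert.1 hC with rfl | hC
    · exact key _ hCS B (he𝒜 hB) hAB hi
    · rw [Finset.mem_singleton.1 hC] at hCS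
      rw [Finset.pair_comm]
      exact key B hCS A (he𝒜 hA) hAB.symm hi.symm
  have := Finset.card_union_le I J
  omega

theorem incCount_le (h : IsDisc 𝒜 S o R) : (incCount 𝒜 S : ℝ) ≤ (49 / 11 : ℝ) * S.card := by
  obtain ⟨s, hs⟩ := h.nonempty
  have h1 := h.toConfig.adj_add_incidence_le Finset.univ ⟨⟨s, hs⟩, Finset.mem_univ _⟩
  have h2 := h.two_mul_incCount_le
  rw [Finset.card_univ, Fintype.card_coe] at h1
  have h3 : 11 * incCount 𝒜 S ≤ 49 * S.card := by omega
  have h4 : (11 : ℝ) * incCount 𝒜 S ≤ 49 * S.card := by exact_mod_cast h3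
  linarith

end IsDisc

end Circ

theorem stmt11 (𝒜 : Finset Circ) (hne : 𝒜.Nonempty)
    (ho : (𝒜 : Set Circ).Pairwise fun X Y => Intersects X Y → Orthogonal X Y) :
    ∃ S ⊆ 𝒜, S.Nonempty ∧ (incCount 𝒜 S : ℝ) ≤ (49 / 11 : ℝ) * S.card := by
  obtain ⟨S, o, R, h⟩ := exists_isDisc hne ho
  exact ⟨S, h.subset, h.nonempty, h.incCount_le⟩
end

section
/- Every finite simple graph with at most seven vertices that contains no triangle and no induced cycle of length four has at most 8 edges. -/
open scoped Classical

open Circ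

namespace SimpleGraph

variable {V : Type*} [Fintype V] [DecidableEq V] (G : SimpleGraph V) [DecidableRel G.Adj]

/-- Counting pairs of edges at a common vertex by their outer endpoints. -/
theorem sum_card_neighborFinset_inter :
    ∑ a, ∑ b, (G.neighborFinset a ∩ G.neighborFinset b).card = ∑ v, G.degree v ^ 2 := by
  have hcard (a b : V) : (G.neighborFinset a ∩ G.neighborFinset b).card =
      ∑ v, (if G.Adj v a then 1 else 0) * (if G.Adj v b then 1 else 0) := by
    rw [show G.neighborFinset a ∩ G.neighborFinset b =
      Finset.univ.filter (fun v => G.Adj v a ∧ G.Adj v b) by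
        ext v; simp [G.adj_comm], Finset.card_filter]
    refine Finset.sum_congr rfl fun v _ => ?_
    by_cases h₁ : G.Adj v a <;> by_cases h₂ : G.Adj v b <;> simp [h₁, h₂]
  have hdeg (v : V) : G.degree v = ∑ a, if G.Adj v a then 1 else 0 := by
    rw [← G.card_neighborFinset_eq_degree, G.neighborFinset_eq_filter, Finset.card_filter]
  simp_rw [hcard, hdeg, sq, Finset.sum_mul_sum]
  rw [Finset.sum_comm_cycle]

/-- If adjacent vertices have no common neighbour and distinct vertices have at most one,
then the sum of the squared degrees is at most `n * (n - 1)`. -/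
theorem sum_degree_sq_add_card_le
    (hadj : ∀ a b, G.Adj a b → G.neighborFinset a ∩ G.neighborFinset b = ∅)
    (hne : ∀ a b, a ≠ b → (G.neighborFinset a ∩ G.neighborFinset b).card ≤ 1) :
    ∑ v, G.degree v ^ 2 + Fintype.card V ≤ Fintype.card V ^ 2 := by
  rw [← G.sum_card_neighborFinset_inter]
  have key (a : V) : ∑ b, (G.neighborFinset a ∩ G.neighborFinset b).card + 1 ≤
      Fintype.card V := by
    have hpt (b : V) : (G.neighborFinset a ∩ G.neighborFinset b).card +
        (if G.Adj a b then 1 else 0) + (if a = b then 1 else 0) ≤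
        1 + if a = b then G.degree a else 0 := by
      by_cases hab : a = b
      · subst hab
        simp [add_comm]
      · by_cases h : G.Adj a b
        · simp [hab, h, hadj a b h]
        · simpa [hab, h] using hne a b hab
    have hsum := Finset.sum_le_sum fun b (_ : b ∈ Finset.univ) => hpt b
    have hdeg : G.degree a = ∑ b, if G.Adj a b then 1 else 0 := by
      rw [← G.card_neighborFinset_eq_degree, G.neighborFinset_eq_filter, Finset.card_filter]
    rw [Finset.sum_add_distrib, Finset.sum_add_distrib, Finset.sum_add_distrib, ← hdeg] at hsum
    simp only [Finset.sum_ite_eq, Finset.mem_univ, if_true, Finset.sum_const,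
      Finset.card_univ, smul_eq_mul, mul_one] at hsum
    omega
  have hsum := Finset.sum_le_sum fun a (_ : a ∈ Finset.univ) => key a
  simpa [Finset.sum_add_distrib, sq] using hsum

end SimpleGraph

theorem stmt13 {V : Type*} [Fintype V] [DecidableEq V]
    (G : SimpleGraph V) [DecidableRel G.Adj]
    (hV : Fintype.card V ≤ 7) (htri : G.CliqueFree 3)
    (hC4 : ¬ ∃ a b c d : V, a ≠ b ∧ a ≠ c ∧ a ≠ d ∧ b ≠ c ∧ b ≠ d ∧ c ≠ d ∧
      G.Adj a b ∧ G.Adj b c ∧ G.Adj c d ∧ G.Adj d a ∧ ¬ G.Adj a c ∧ ¬ G.Adj b d) :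
    G.edgeFinset.card ≤ 8 := by
  have hno (a b c : V) (hab : G.Adj a b) (hbc : G.Adj b c) : ¬ G.Adj a c := fun hac =>
    htri {a, b, c} (SimpleGraph.is3Clique_triple_iff.2 ⟨hab, hac, hbc⟩)
  have hadj (a b : V) (hab : G.Adj a b) : G.neighborFinset a ∩ G.neighborFinset b = ∅ := by
    ext v
    simp only [Finset.mem_inter, SimpleGraph.mem_neighborFinset, Finset.notMem_empty, iff_false]
    exact fun h => hno a b v hab h.2 h.1
  have hne (a b : V) (hab : a ≠ b) :
      (G.neighborFinset a ∩ G.neighborFinset b).card ≤ 1 := by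
    rw [Finset.card_le_one]
    intro x hx y hy
    simp only [Finset.mem_inter, SimpleGraph.mem_neighborFinset] at hx hy
    by_contra hxy
    exact hC4 ⟨a, x, b, y, hx.1.ne, hab, hy.1.ne, hx.2.ne', hxy, hy.2.ne, hx.1, hx.2.symm,
      hy.2, hy.1.symm, hno a x b hx.1 hx.2.symm, hno x a y hx.1.symm hy.1⟩
  have hsq := G.sum_degree_sq_add_card_le hadj hne
  have hcs := sq_sum_le_card_mul_sum_sq (s := Finset.univ) (f := fun v => G.degree v)
  rw [G.sum_degrees_eq_twice_card_edges, Finset.card_univ] at hcs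
  generalize Fintype.card V = n at *
  generalize ∑ v, G.degree v ^ 2 = S at *
  by_contra! h
  have hS : S ≤ 42 := by
    interval_cases n <;> omega
  nlinarith [Nat.mul_le_mul hV hS]
end

section
/- Let A, B, C be three pairwise orthogonal circles in the Euclidean plane with centers C_A, C_B, C_C and radii r_A, r_B, r_C. Then every point of the triangle spanned by C_A, C_B, C_C (i.e. of the convex hull of {C_A, C_B, C_C}) lies in at least one of the three closed disks bounded by A, B, C. -/
open scoped Classical

open Circ

/-- If `x + y + z = 1`, the weighted mean of the squared distances from `x • a + y • b + z • c`
to `a`, `b`, `c` is the weighted sum of the squared pairwise distances. -/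
theorem weighted_sum_sq_dist_eq (a b c : EuclideanSpace ℝ (Fin 2)) {x y z : ℝ}
    (h : x + y + z = 1) :
    x * dist (x • a + y • b + z • c) a ^ 2 + y * dist (x • a + y • b + z • c) b ^ 2 +
      z * dist (x • a + y • b + z • c) c ^ 2 =
    x * y * dist a b ^ 2 + x * z * dist a c ^ 2 + y * z * dist b c ^ 2 := by
  obtain rfl : z = 1 - x - y := by linarith
  simp only [EuclideanSpace.dist_sq_eq, Fin.sum_univ_two, Real.dist_eq, sq_abs, PiLp.add_apply,
    PiLp.smul_apply, smul_eq_mul]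
  ring

theorem stmt15 (A B C : Circ)
    (hAB : Orthogonal A B) (hAC : Orthogonal A C) (hBC : Orthogonal B C) :
    convexHull ℝ {A.center, B.center, C.center} ⊆
      A.closedDisk ∪ B.closedDisk ∪ C.closedDisk := by
  intro p hp
  rw [convexHull_insert (Set.insert_nonempty _ _), convexHull_pair, mem_convexJoin] at hp
  obtain ⟨_, rfl, _, ⟨s, t, hs, ht, hst, rfl⟩, u, v, hu, hv, huv, rfl⟩ := hp
  rw [smul_add, smul_smul, smul_smul, ← add_assoc]
  have hy : 0 ≤ v * s := mul_nonneg hv hs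
  have hz : 0 ≤ v * t := mul_nonneg hv ht
  have hsum : u + v * s + v * t = 1 := by rw [add_assoc, ← mul_add, hst, mul_one, huv]
  generalize v * s = y at *
  generalize v * t = z at *
  have key := weighted_sum_sq_dist_eq A.center B.center C.center hsum
  rw [hAB.2, hAC.2, hBC.2] at key
  simp only [closedDisk, Set.mem_union, Metric.mem_closedBall]
  by_contra! hout
  obtain ⟨⟨hA, hB⟩, hC⟩ := hout
  have hA' := mul_le_mul_of_nonneg_left (pow_le_pow_left₀ A.radius_pos.le hA.le 2) hu
  have hB' := mul_le_mul_of_nonneg_left (pow_le_pow_left₀ B.radius_pos.le hB.le 2) hy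
  have hC' := mul_le_mul_of_nonneg_left (pow_le_pow_left₀ C.radius_pos.le hC.le 2) hz
  have hsq : (u * A.radius) ^ 2 + (y * B.radius) ^ 2 + (z * C.radius) ^ 2 ≤ 0 := by
    obtain rfl : z = 1 - u - y := by linarith
    linarith
  have weight_eq_zero {w r : ℝ} (hr : 0 < r) (hw : (w * r) ^ 2 ≤ 0) : w = 0 := by
    simpa [hr.ne'] using le_antisymm hw (sq_nonneg _)
  have := weight_eq_zero A.radius_pos (w := u) (by
    linarith [sq_nonneg (y * B.radius), sq_nonneg (z * C.radius)])
  have := weight_eq_zero B.radius_pos (w := y) (by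
    linarith [sq_nonneg (u * A.radius), sq_nonneg (z * C.radius)])
  have := weight_eq_zero C.radius_pos (w := z) (by
    linarith [sq_nonneg (u * A.radius), sq_nonneg (y * B.radius)])
  linarith
end
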